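/- For every positive integer n, the number of representations of n by the octonary quadratic form x1^2 + 2x2^2 + 2x3^2 + 2x4^2 + 4x5^2 + 4x6^2 + 4x7^2 + 4x8^2 equals (4/11)σ_{3;χ8,1}(n) + (2/11)σ_{3;1,χ8}(n/2) + (1/11)a1(n) + (17/11)a2(n) + (48/11)a1(n/2) + (16/11)a2(n/2), where terms with non-integer argument n/2 are interpreted as 0. -/

import Mathlib

section
open Complex Real Finset

/-- The Dedekind eta function `η(z) = q^{1/24} ∏ (1 - q^m)`, `q = e^{2πiz}`. -/
noncomputable def dedekindEta (z : ℂ) : ℂ :=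
  Complex.exp (Real.pi * Complex.I * z / 12) *
    ∏' m : ℕ, (1 - Complex.exp (2 * Real.pi * Complex.I * (m + 1) * z))

/-- `repCount a n` is the number of `(x₁,…,x₈) ∈ ℤ⁸` with `∑ aᵢ xᵢ² = n`. -/
noncomputable def repCount (a : Fin 8 → ℕ) (n : ℕ) : ℕ :=
  Nat.card {x : Fin 8 → ℤ // ∑ i, (a i : ℤ) * x i ^ 2 = (n : ℤ)}

/-- `σ_{3;1,χ₈}(n) = ∑_{d ∣ n} χ₈(d) d³`. -/
def sigmaOneChi8 (n : ℕ) : ℤ := ∑ d ∈ n.divisors, ZMod.χ₈ (d : ZMod 8) * (d : ℤ) ^ 3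

/-- `σ_{3;χ₈,1}(n) = ∑_{d ∣ n} χ₈(n/d) d³`. -/
def sigmaChi8One (n : ℕ) : ℤ := ∑ d ∈ n.divisors, ZMod.χ₈ ((n / d : ℕ) : ZMod 8) * (d : ℤ) ^ 3

/-- `f(n/2)` when `2 ∣ n`, and `0` otherwise. -/
def half (f : ℕ → ℤ) (n : ℕ) : ℚ := if 2 ∣ n then (f (n / 2) : ℚ) else 0

end


namespace Rep

/-- Geometric decay of a bilateral sequence. -/
def Dec (f : ℤ → ℝ) : Prop :=
  ∃ r C : ℝ, 0 < r ∧ r < 1 ∧ ∀ n : ℤ, |f n| ≤ C * r ^ n.natAbs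

lemma summable_natAbs {r : ℝ} (h0 : 0 < r) (h1 : r < 1) :
    Summable fun n : ℤ => r ^ n.natAbs := by
  apply Summable.of_nat_of_neg
  · simpa using summable_geometric_of_lt_one h0.le h1
  · simpa using summable_geometric_of_lt_one h0.le h1

lemma Dec.summable {f : ℤ → ℝ} (hf : Dec f) : Summable f := by
  obtain ⟨r, C, h0, h1, h⟩ := hf
  exact Summable.of_norm_bounded ((summable_natAbs h0 h1).mul_left C) h

lemma Dec.mono {f g : ℤ → ℝ} (hg : Dec g) (K : ℝ) (hK : 0 ≤ K) (h : ∀ n, |f n| ≤ K * |g n|) :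
    Dec f := by
  obtain ⟨r, C, h0, h1, h'⟩ := hg
  refine ⟨r, K * C, h0, h1, fun n => (h n).trans ?_⟩
  rw [mul_assoc]
  exact mul_le_mul_of_nonneg_left (h' n) hK

lemma Dec.congr {f g : ℤ → ℝ} (hg : Dec g) (h : ∀ n, f n = g n) : Dec f := by
  have : f = g := funext h
  rwa [this]

lemma Dec.const_mul {f : ℤ → ℝ} (hf : Dec f) (c : ℝ) : Dec fun n => c * f n :=
  hf.mono |c| (abs_nonneg _) fun n => by rw [abs_mul]

lemma Dec.add {f g : ℤ → ℝ} (hf : Dec f) (hg : Dec g) : Dec fun n => f n + g n := by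
  obtain ⟨r, C, h0, h1, h⟩ := hf
  obtain ⟨s, D, h0', h1', h'⟩ := hg
  have hC : 0 ≤ C := by simpa using (abs_nonneg _).trans (h 0)
  have hD : 0 ≤ D := by simpa using (abs_nonneg _).trans (h' 0)
  refine ⟨max r s, C + D, lt_max_of_lt_left h0, max_lt h1 h1', fun n => ?_⟩
  calc |f n + g n| ≤ |f n| + |g n| := abs_add_le _ _
    _ ≤ C * r ^ n.natAbs + D * s ^ n.natAbs := add_le_add (h n) (h' n)
    _ ≤ C * (max r s) ^ n.natAbs + D * (max r s) ^ n.natAbs := by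
        gcongr
        · exact le_max_left _ _
        · exact le_max_right _ _
    _ = _ := by ring

lemma Dec.mul_id {f : ℤ → ℝ} (hf : Dec f) : Dec fun n => (n : ℝ) * f n := by
  obtain ⟨r, C, h0, h1, h⟩ := hf
  have hC : 0 ≤ C := by simpa using (abs_nonneg _).trans (h 0)
  obtain ⟨s, hrs, hs1⟩ := exists_between h1
  have hs0 : 0 < s := h0.trans hrs
  have hsum := summable_pow_mul_geometric_of_norm_lt_one (R := ℝ) 1 (r := r / s) (by
    rw [Real.norm_eq_abs, abs_of_pos (by positivity)]
    exact (div_lt_one hs0).2 hrs)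
  obtain ⟨M, hM⟩ := (hsum.tendsto_atTop_zero.bddAbove_range)
  refine ⟨s, C * M, hs0, hs1, fun n => ?_⟩
  have h2 := hM ⟨n.natAbs, rfl⟩
  simp only [pow_one] at h2
  have h3 : (n.natAbs : ℝ) * r ^ n.natAbs ≤ M * s ^ n.natAbs := by
    rw [div_pow, ← mul_div_assoc, div_le_iff₀ (by positivity)] at h2
    exact h2
  have h4 : |(n : ℝ)| = (n.natAbs : ℝ) := by
    rw [Nat.cast_natAbs]; simp
  rw [abs_mul, h4]
  calc (n.natAbs : ℝ) * |f n| ≤ n.natAbs * (C * r ^ n.natAbs) := by gcongr; exact h n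
    _ = C * (n.natAbs * r ^ n.natAbs) := by ring
    _ ≤ C * (M * s ^ n.natAbs) := by gcongr
    _ = _ := by ring

lemma Dec.mul_lin {f : ℤ → ℝ} (hf : Dec f) (a b : ℝ) : Dec fun n => (a * n + b) * f n :=
  ((hf.mul_id.const_mul a).add (hf.const_mul b)).congr fun n => by ring

lemma dec_geom {q : ℝ} (h0 : 0 < q) (h1 : q < 1) {f : ℤ → ℝ} {C : ℝ}
    (h : ∀ n : ℤ, |f n| ≤ C * q ^ |n|) : Dec f := by
  refine ⟨q, C, h0, h1, fun n => ?_⟩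
  have := h n
  rwa [Int.abs_eq_natAbs, zpow_natCast] at this

lemma dec_gauss {q : ℝ} (h0 : 0 < q) (h1 : q < 1) {f : ℤ → ℝ} {C : ℝ} (b c : ℤ)
    (h : ∀ n : ℤ, |f n| ≤ C * q ^ (n ^ 2 + b * n + c)) : Dec f := by
  have hC : 0 ≤ C := by
    have := (abs_nonneg _).trans (h 0)
    exact nonneg_of_mul_nonneg_left this (by positivity)
  apply dec_geom h0 h1 (C := C * q ^ (-(|b| + 1) ^ 2 + c))
  intro n
  refine (h n).trans ?_
  rw [mul_assoc, ← zpow_add₀ h0.ne']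
  apply mul_le_mul_of_nonneg_left _ hC
  apply zpow_le_zpow_right_of_le_one₀ h0 h1.le
  have h2 : -(|b| * |n|) ≤ b * n := by rw [← abs_mul]; exact neg_abs_le _
  have h3 : n ^ 2 = |n| ^ 2 := (sq_abs n).symm
  rw [h3]
  nlinarith [abs_nonneg n, abs_nonneg b, sq_nonneg (2 * |n| - (|b| + 1)), sq_nonneg (|b| + 1)]

lemma Dec.mul_summable {f g : ℤ → ℝ} (hf : Dec f) (hg : Dec g) :
    Summable fun p : ℤ × ℤ => f p.1 * g p.2 :=
  summable_mul_of_summable_norm hf.summable.norm hg.summable.norm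

lemma Dec.tsum_mul {f g : ℤ → ℝ} (hf : Dec f) (hg : Dec g) :
    (∑' n, f n) * (∑' n, g n) = ∑' p : ℤ × ℤ, f p.1 * g p.2 :=
  tsum_mul_tsum_of_summable_norm hf.summable.norm hg.summable.norm

/-- Rearranging a weighted sum of convolutions. -/
lemma conv_sum {f g h : ℤ → ℝ} {s : ℤ → ℤ}
    (hs : Summable fun p : ℤ × ℤ => h (p.1 + s p.2) * (f p.1 * g p.2)) :
    ∑' K, h K * ∑' j, f (K - s j) * g j
      = ∑' p : ℤ × ℤ, h (p.1 + s p.2) * (f p.1 * g p.2) := by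
  let e : ℤ × ℤ ≃ ℤ × ℤ :=
    { toFun := fun p => (p.1 - s p.2, p.2)
      invFun := fun p => (p.1 + s p.2, p.2)
      left_inv := fun p => by simp
      right_inv := fun p => by simp }
  rw [← e.tsum_eq]
  have hs' := e.summable_iff.2 hs
  have : ∀ p : ℤ × ℤ, h ((e p).1 + s (e p).2) * (f (e p).1 * g (e p).2)
      = h p.1 * (f (p.1 - s p.2) * g p.2) := fun p => by simp [e]
  simp_rw [Function.comp_def, this] at hs'
  simp_rw [this]
  rw [hs'.tsum_prod]
  simp_rw [tsum_mul_left]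

lemma mom1 {f g u v : ℤ → ℝ} (f0 : Dec f) (f1 : Dec fun n => u n * f n)
    (g0 : Dec g) (g1 : Dec fun n => v n * g n) :
    HasSum (fun p : ℤ × ℤ => (u p.1 + v p.2) * (f p.1 * g p.2))
      ((∑' n, u n * f n) * (∑' n, g n) + (∑' n, f n) * (∑' n, v n * g n)) := by
  have a := (f1.mul_summable g0).hasSum
  have b := (f0.mul_summable g1).hasSum
  rw [← f1.tsum_mul g0] at a
  rw [← f0.tsum_mul g1] at b
  convert a.add b using 1
  funext p
  ring

lemma mom3 {f g u v : ℤ → ℝ} (f0 : Dec f) (f1 : Dec fun n => u n * f n)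
    (f2 : Dec fun n => u n ^ 2 * f n) (f3 : Dec fun n => u n ^ 3 * f n)
    (g0 : Dec g) (g1 : Dec fun n => v n * g n)
    (g2 : Dec fun n => v n ^ 2 * g n) (g3 : Dec fun n => v n ^ 3 * g n) :
    HasSum (fun p : ℤ × ℤ => (u p.1 + v p.2) ^ 3 * (f p.1 * g p.2))
      ((∑' n, u n ^ 3 * f n) * (∑' n, g n) + 3 * ((∑' n, u n ^ 2 * f n) * (∑' n, v n * g n))
        + 3 * ((∑' n, u n * f n) * (∑' n, v n ^ 2 * g n))
        + (∑' n, f n) * (∑' n, v n ^ 3 * g n)) := by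
  have a := (f3.mul_summable g0).hasSum
  have b := (f2.mul_summable g1).hasSum
  have c := (f1.mul_summable g2).hasSum
  have d := (f0.mul_summable g3).hasSum
  rw [← f3.tsum_mul g0] at a
  rw [← f2.tsum_mul g1] at b
  rw [← f1.tsum_mul g2] at c
  rw [← f0.tsum_mul g3] at d
  convert ((a.add (b.mul_left 3)).add (c.mul_left 3)).add d using 1
  funext p
  ring

lemma tsum_two_ranges {α β γ : Type*} {i : α → γ} {k : β → γ} (hi : Function.Injective i)
    (hk : Function.Injective k) (hc : IsCompl (Set.range i) (Set.range k)) {F : γ → ℝ}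
    (hF : Summable F) : ∑' x, F x = ∑' a, F (i a) + ∑' b, F (k b) := by
  have h1 : Summable (F ∘ i) := hF.comp_injective hi
  have h2 : Summable (F ∘ k) := hF.comp_injective hk
  exact (HasSum.add_isCompl hc (hi.hasSum_range_iff.2 h1.hasSum)
    (hk.hasSum_range_iff.2 h2.hasSum)).tsum_eq

lemma tsum_split {F : ℤ × ℤ → ℝ} (hF : Summable F) :
    ∑' p, F p = ∑' p : ℤ × ℤ, F (p.1 + p.2, p.1 - p.2)
      + ∑' p : ℤ × ℤ, F (p.1 + p.2 + 1, p.1 - p.2) := by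
  apply tsum_two_ranges (i := fun p : ℤ × ℤ => (p.1 + p.2, p.1 - p.2))
    (k := fun p : ℤ × ℤ => (p.1 + p.2 + 1, p.1 - p.2)) _ _ _ hF
  · rintro ⟨a, b⟩ ⟨c, d⟩ h
    simp only [Prod.mk.injEq] at h ⊢
    omega
  · rintro ⟨a, b⟩ ⟨c, d⟩ h
    simp only [Prod.mk.injEq] at h ⊢
    omega
  · constructor
    · rw [Set.disjoint_left]
      rintro _ ⟨⟨a, b⟩, rfl⟩ ⟨⟨c, d⟩, h⟩
      simp only [Prod.mk.injEq] at h
      omega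
    · rw [codisjoint_iff_compl_le_right]
      rintro ⟨x, y⟩ h
      by_contra h'
      rcases Int.even_or_odd' (x + y) with ⟨k, hk | hk⟩
      · exact h ⟨(k, x - k), by simp only [Prod.mk.injEq]; omega⟩
      · exact h' ⟨(k, x - k - 1), by simp only [Prod.mk.injEq]; omega⟩

lemma tsum_even_odd {F : ℤ → ℝ} (hF : Summable F) :
    ∑' n, F n = ∑' n, F (2 * n) + ∑' n, F (2 * n + 1) := by
  apply tsum_two_ranges (i := fun p : ℤ => 2 * p) (k := fun p : ℤ => 2 * p + 1) _ _ _ hF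
  · intro a b h; simp only at h; omega
  · intro a b h; simp only at h; omega
  · constructor
    · rw [Set.disjoint_left]
      rintro _ ⟨a, rfl⟩ ⟨c, h⟩
      simp only at h
      omega
    · rw [codisjoint_iff_compl_le_right]
      rintro x h
      by_contra h'
      rcases Int.even_or_odd' x with ⟨k, hk | hk⟩
      · exact h ⟨k, hk.symm⟩
      · exact h' ⟨k, hk.symm⟩

/-- A bilateral sum vanishes when an affine reflection negates its terms. -/
lemma tsum_refl_zero {F : ℤ → ℝ} (c : ℤ) (h : ∀ n, F (c - n) = - F n) : ∑' n, F n = 0 := by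
  have := (Equiv.subLeft c).tsum_eq F
  simp only [Equiv.subLeft_apply, h, tsum_neg] at this
  linarith

lemma tsum_refl {F : ℤ → ℝ} (c : ℤ) : ∑' n, F (c - n) = ∑' n, F n :=
  (Equiv.subLeft c).tsum_eq F

lemma tsum_shift {F : ℤ → ℝ} (c : ℤ) : ∑' n, F (n + c) = ∑' n, F n :=
  (Equiv.addRight c).tsum_eq F

end Rep


namespace Rep

/-- The sign `(-1)^n` as a real number. -/
noncomputable def sg (n : ℤ) : ℝ := (-1) ^ n

lemma sg_add (a b : ℤ) : sg (a + b) = sg a * sg b := zpow_add₀ (by norm_num) a b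
lemma sg_neg (a : ℤ) : sg (-a) = sg a := by
  rw [sg, sg, zpow_neg, ← inv_zpow, inv_neg_one]
lemma sg_sub (a b : ℤ) : sg (a - b) = sg a * sg b := by rw [sub_eq_add_neg, sg_add, sg_neg]
lemma sg_one : sg 1 = -1 := by simp [sg]
lemma sg_zero : sg 0 = 1 := by simp [sg]
lemma sg_mul_self (a : ℤ) : sg a * sg a = 1 := by
  rw [← sg_add]
  exact Even.neg_one_zpow ⟨a, rfl⟩
lemma sg_sq (a : ℤ) : sg a ^ 2 = 1 := by rw [sq, sg_mul_self]
lemma sg_two_mul (a : ℤ) : sg (2 * a) = 1 := by rw [two_mul, sg_add, sg_mul_self]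
lemma abs_sg (a : ℤ) : |sg a| = 1 := by simp [sg]

lemma sqz (q : ℝ) (m : ℤ) : (q ^ 2) ^ m = q ^ (2 * m) := by
  rw [zpow_mul]; norm_cast
lemma q4z (q : ℝ) (m : ℤ) : (q ^ 4) ^ m = q ^ (4 * m) := by
  rw [zpow_mul]; norm_cast

lemma dec_quad {q : ℝ} (h0 : 0 < q) (h1 : q < 1) {f : ℤ → ℝ} {C : ℝ} (a b c : ℤ) (ha : 1 ≤ a)
    (h : ∀ n : ℤ, |f n| ≤ C * q ^ (a * n ^ 2 + b * n + c)) : Dec f := by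
  have hC : 0 ≤ C := by
    have := (abs_nonneg _).trans (h 0)
    exact nonneg_of_mul_nonneg_left this (by positivity)
  refine dec_gauss h0 h1 (C := C) b c fun n => (h n).trans ?_
  apply mul_le_mul_of_nonneg_left _ hC
  apply zpow_le_zpow_right_of_le_one₀ h0 h1.le
  nlinarith [sq_nonneg n]

lemma dec_q {q : ℝ} (h0 : 0 < q) (h1 : q < 1) (a b c : ℤ) (ha : 1 ≤ a) :
    Dec fun n => q ^ (a * n ^ 2 + b * n + c) :=
  dec_quad h0 h1 (C := 1) a b c ha fun n => by rw [abs_of_pos (by positivity), one_mul]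

lemma dec_sq {q : ℝ} (h0 : 0 < q) (h1 : q < 1) (a b c : ℤ) (ha : 1 ≤ a) :
    Dec fun n => sg n * q ^ (a * n ^ 2 + b * n + c) :=
  dec_quad h0 h1 (C := 1) a b c ha fun n => by
    rw [abs_mul, abs_sg, abs_of_pos (by positivity)]

lemma split_prod {f g u v u' v' : ℤ → ℝ} (hf : Dec f) (hg : Dec g) (hu : Dec u) (hv : Dec v)
    (hu' : Dec u') (hv' : Dec v') (he : ∀ s t, f (s + t) * g (s - t) = u s * v t)
    (ho : ∀ s t, f (s + t + 1) * g (s - t) = u' s * v' t) :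
    (∑' n, f n) * (∑' n, g n) = (∑' n, u n) * (∑' n, v n) + (∑' n, u' n) * (∑' n, v' n) := by
  rw [hf.tsum_mul hg, hu.tsum_mul hv, hu'.tsum_mul hv', tsum_split (hf.mul_summable hg)]
  simp_rw [he, ho]

noncomputable def thA (q : ℝ) : ℝ := ∑' n : ℤ, q ^ (n ^ 2)
noncomputable def thB (q : ℝ) : ℝ := ∑' n : ℤ, sg n * q ^ (n ^ 2)
noncomputable def Psi (q : ℝ) : ℝ := ∑' n : ℤ, q ^ (n ^ 2 + n)
noncomputable def jj (q : ℝ) : ℝ := ∑' n : ℤ, sg n * (2 * n + 1) * q ^ (n ^ 2 + n)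
noncomputable def hh (q : ℝ) : ℝ := ∑' n : ℤ, sg n * q ^ (2 * n ^ 2 + n)

section
variable {q : ℝ} (h0 : 0 < q) (h1 : q < 1)

lemma sq_lt_one : 0 < q → q < 1 → 0 < q ^ 2 ∧ q ^ 2 < 1 := fun h0 h1 =>
  ⟨by positivity, by nlinarith⟩
lemma q4_lt_one : 0 < q → q < 1 → 0 < q ^ 4 ∧ q ^ 4 < 1 := fun h0 h1 =>
  ⟨by positivity, pow_lt_one₀ h0.le h1 (by norm_num)⟩

lemma decA (h0 : 0 < q) (h1 : q < 1) : Dec fun n : ℤ => q ^ (n ^ 2) :=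
  (dec_q h0 h1 1 0 0 le_rfl).congr fun n => by simp
lemma decB (h0 : 0 < q) (h1 : q < 1) : Dec fun n : ℤ => sg n * q ^ (n ^ 2) :=
  (dec_sq h0 h1 1 0 0 le_rfl).congr fun n => by simp
lemma decPsi (h0 : 0 < q) (h1 : q < 1) : Dec fun n : ℤ => q ^ (n ^ 2 + n) :=
  (dec_q h0 h1 1 1 0 le_rfl).congr fun n => by simp
lemma decPsi' (h0 : 0 < q) (h1 : q < 1) : Dec fun n : ℤ => sg n * q ^ (n ^ 2 + n) :=
  (dec_sq h0 h1 1 1 0 le_rfl).congr fun n => by simp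
lemma decjj (h0 : 0 < q) (h1 : q < 1) : Dec fun n : ℤ => sg n * (2 * n + 1) * q ^ (n ^ 2 + n) :=
  ((decPsi' h0 h1).mul_lin 2 1).congr fun n => by ring
lemma dech (h0 : 0 < q) (h1 : q < 1) : Dec fun n : ℤ => sg n * q ^ (2 * n ^ 2 + n) :=
  (dec_sq h0 h1 2 1 0 (by norm_num)).congr fun n => by simp

lemma sum_psi_alt : ∑' n : ℤ, sg n * q ^ (n ^ 2 + n) = 0 := by
  apply tsum_refl_zero (-1)
  intro n
  rw [sg_sub, sg_neg, sg_one, show (-1 - n) ^ 2 + (-1 - n) = n ^ 2 + n by ring]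
  ring

lemma A_sq (h0 : 0 < q) (h1 : q < 1) : thA q ^ 2 = thA (q ^ 2) ^ 2 + q * Psi (q ^ 2) ^ 2 := by
  obtain ⟨k0, k1⟩ := sq_lt_one h0 h1
  have := split_prod (decA h0 h1) (decA h0 h1) (decA k0 k1) (decA k0 k1)
    ((decPsi k0 k1).const_mul q) (decPsi k0 k1)
    (fun s t => by
      rw [sqz, sqz, ← zpow_add₀ h0.ne', ← zpow_add₀ h0.ne']; congr 1; ring)
    (fun s t => by
      rw [sqz, sqz, mul_assoc, ← zpow_add₀ h0.ne', ← zpow_add₀ h0.ne', ← zpow_one_add₀ h0.ne']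
      congr 1; ring)
  rw [tsum_mul_left] at this
  simp only [thA, Psi]
  linear_combination this

lemma B_sq (h0 : 0 < q) (h1 : q < 1) : thB q ^ 2 = thA (q ^ 2) ^ 2 - q * Psi (q ^ 2) ^ 2 := by
  obtain ⟨k0, k1⟩ := sq_lt_one h0 h1
  have := split_prod (decB h0 h1) (decB h0 h1) (decA k0 k1) (decA k0 k1)
    ((decPsi k0 k1).const_mul (-q)) (decPsi k0 k1)
    (fun s t => by
      have : q ^ ((s + t) ^ 2) * q ^ ((s - t) ^ 2) = (q ^ 2) ^ s ^ 2 * (q ^ 2) ^ t ^ 2 := by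
        rw [sqz, sqz, ← zpow_add₀ h0.ne', ← zpow_add₀ h0.ne']; congr 1; ring
      rw [sg_add, sg_sub]
      linear_combination (sg s * sg t) ^ 2 * this + (q ^ 2) ^ s ^ 2 * (q ^ 2) ^ t ^ 2 *
        (sg t ^ 2 * sg_sq s + sg_sq t))
    (fun s t => by
      have : q ^ ((s + t + 1) ^ 2) * q ^ ((s - t) ^ 2)
          = q * (q ^ 2) ^ (s ^ 2 + s) * (q ^ 2) ^ (t ^ 2 + t) := by
        rw [sqz, sqz, mul_assoc, ← zpow_add₀ h0.ne', ← zpow_add₀ h0.ne', ← zpow_one_add₀ h0.ne']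
        congr 1; ring
      rw [sg_add, sg_add, sg_sub, sg_one]
      linear_combination -(sg s * sg t) ^ 2 * this - q * (q ^ 2) ^ (s ^ 2 + s) *
        (q ^ 2) ^ (t ^ 2 + t) * (sg t ^ 2 * sg_sq s + sg_sq t))
  rw [tsum_mul_left] at this
  simp only [thB, thA, Psi]
  linear_combination this

lemma AB_eq (h0 : 0 < q) (h1 : q < 1) : thA q * thB q = thB (q ^ 2) ^ 2 := by
  obtain ⟨k0, k1⟩ := sq_lt_one h0 h1
  have := split_prod (decA h0 h1) (decB h0 h1) (decB k0 k1) (decB k0 k1)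
    ((decPsi' k0 k1).const_mul q) (decPsi' k0 k1)
    (fun s t => by
      have : q ^ ((s + t) ^ 2) * q ^ ((s - t) ^ 2) = (q ^ 2) ^ s ^ 2 * (q ^ 2) ^ t ^ 2 := by
        rw [sqz, sqz, ← zpow_add₀ h0.ne', ← zpow_add₀ h0.ne']; congr 1; ring
      rw [sg_sub]
      linear_combination (sg s * sg t) * this)
    (fun s t => by
      have : q ^ ((s + t + 1) ^ 2) * q ^ ((s - t) ^ 2)
          = q * (q ^ 2) ^ (s ^ 2 + s) * (q ^ 2) ^ (t ^ 2 + t) := by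
        rw [sqz, sqz, mul_assoc, ← zpow_add₀ h0.ne', ← zpow_add₀ h0.ne', ← zpow_one_add₀ h0.ne']
        congr 1; ring
      rw [sg_sub]
      linear_combination (sg s * sg t) * this)
  rw [sum_psi_alt] at this
  simp only [thB, thA]
  linear_combination this

lemma Psi_sq (h0 : 0 < q) (h1 : q < 1) : Psi q ^ 2 = 2 * thA (q ^ 2) * Psi (q ^ 2) := by
  obtain ⟨k0, k1⟩ := sq_lt_one h0 h1
  have d2 : Dec fun n : ℤ => (q ^ 2) ^ ((n + 1) ^ 2) :=
    (dec_q k0 k1 1 2 1 le_rfl).congr fun n => by congr 1; ring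
  have := split_prod (decPsi h0 h1) (decPsi h0 h1) (decPsi k0 k1) (decA k0 k1)
    d2 (decPsi k0 k1)
    (fun s t => by
      rw [sqz, sqz, ← zpow_add₀ h0.ne', ← zpow_add₀ h0.ne']; congr 1; ring)
    (fun s t => by
      rw [sqz, sqz, ← zpow_add₀ h0.ne', ← zpow_add₀ h0.ne']
      congr 1; ring)
  rw [tsum_shift (F := fun n : ℤ => (q ^ 2) ^ (n ^ 2)) 1] at this
  simp only [thA, Psi]
  linear_combination this

lemma A_split (h0 : 0 < q) (h1 : q < 1) : thA q = thA (q ^ 4) + q * Psi (q ^ 4) := by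
  rw [thA, tsum_even_odd (decA h0 h1).summable, thA, Psi, ← tsum_mul_left]
  congr 1
  · congr 1; funext n; rw [q4z]; congr 1; ring
  · congr 1; funext n; rw [q4z, ← zpow_one_add₀ h0.ne']; congr 1; ring

lemma B_split (h0 : 0 < q) (h1 : q < 1) : thB q = thA (q ^ 4) - q * Psi (q ^ 4) := by
  rw [thB, tsum_even_odd (decB h0 h1).summable, thA, Psi, ← tsum_mul_left, sub_eq_add_neg,
    ← tsum_neg]
  congr 1
  · congr 1; funext n; rw [q4z, sg_two_mul, one_mul]; congr 1; ring
  · congr 1; funext n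
    rw [q4z, ← zpow_one_add₀ h0.ne', sg_add, sg_two_mul, sg_one, one_mul, neg_one_mul]
    congr 2; ring

lemma hh_sq (h0 : 0 < q) (h1 : q < 1) : 2 * hh q ^ 2 = Psi q * thB q := by
  obtain ⟨k0, k1⟩ := q4_lt_one h0 h1
  have dk : Dec fun n : ℤ => q ^ (4 * n ^ 2 + 2 * n) :=
    (dec_q h0 h1 4 2 0 (by norm_num)).congr fun n => by simp
  have dk2 : Dec fun n : ℤ => q ^ (4 * (-1 - n) ^ 2 + 2 * (-1 - n)) :=
    (dec_q h0 h1 4 6 2 (by norm_num)).congr fun n => by congr 1; ring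
  have hk2 := tsum_refl (F := fun n : ℤ => q ^ (4 * n ^ 2 + 2 * n)) (-1)
  have hPsi : Psi q = 2 * ∑' n : ℤ, q ^ (4 * n ^ 2 + 2 * n) := by
    rw [Psi, tsum_even_odd (decPsi h0 h1).summable, two_mul]
    congr 1
    · congr 1; funext n; congr 1; ring
    · rw [← hk2]; congr 1; funext n; congr 1; ring
  have := split_prod (dech h0 h1) (dech h0 h1) dk (decA k0 k1)
    dk2 ((decPsi k0 k1).const_mul (-q))
    (fun s t => by
      have : q ^ (2 * (s + t) ^ 2 + (s + t)) * q ^ (2 * (s - t) ^ 2 + (s - t))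
          = q ^ (4 * s ^ 2 + 2 * s) * (q ^ 4) ^ t ^ 2 := by
        rw [q4z, ← zpow_add₀ h0.ne', ← zpow_add₀ h0.ne']; congr 1; ring
      rw [sg_add, sg_sub]
      linear_combination (sg s * sg t) ^ 2 * this + q ^ (4 * s ^ 2 + 2 * s) * (q ^ 4) ^ t ^ 2 *
        (sg t ^ 2 * sg_sq s + sg_sq t))
    (fun s t => by
      have : q ^ (2 * (s + t + 1) ^ 2 + (s + t + 1)) * q ^ (2 * (s - t) ^ 2 + (s - t))
          = q ^ (4 * (-1 - s) ^ 2 + 2 * (-1 - s)) * (q * (q ^ 4) ^ (t ^ 2 + t)) := by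
        rw [q4z, ← zpow_one_add₀ h0.ne', ← zpow_add₀ h0.ne', ← zpow_add₀ h0.ne']
        congr 1; ring
      rw [sg_add, sg_add, sg_sub, sg_one]
      linear_combination -(sg s * sg t) ^ 2 * this - q ^ (4 * (-1 - s) ^ 2 + 2 * (-1 - s)) *
        (q * (q ^ 4) ^ (t ^ 2 + t)) * (sg t ^ 2 * sg_sq s + sg_sq t))
  rw [tsum_mul_left, hk2] at this
  rw [hPsi, B_split h0 h1]
  simp only [hh, thA]
  rw [sq, this, Psi]
  ring

noncomputable def A2 (q : ℝ) : ℝ := ∑' n : ℤ, (n : ℝ) ^ 2 * q ^ (n ^ 2)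
noncomputable def B2 (q : ℝ) : ℝ := ∑' n : ℤ, (n : ℝ) ^ 2 * (sg n * q ^ (n ^ 2))

lemma Dec.sq {f : ℤ → ℝ} (hf : Dec f) : Dec fun n => (n : ℝ) ^ 2 * f n :=
  hf.mul_id.mul_id.congr fun n => by ring
lemma Dec.cube {f : ℤ → ℝ} (hf : Dec f) : Dec fun n => (n : ℝ) ^ 3 * f n :=
  hf.mul_id.mul_id.mul_id.congr fun n => by ring

lemma A2B (h0 : 0 < q) (h1 : q < 1) :
    A2 q * thB q - thA q * B2 q = q * jj (q ^ 2) ^ 2 := by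
  obtain ⟨k0, k1⟩ := sq_lt_one h0 h1
  have dv : Dec fun n : ℤ => (-(n : ℝ) ^ 2) * (sg n * q ^ (n ^ 2)) :=
    ((decB h0 h1).sq.const_mul (-1)).congr fun n => by ring
  have H := mom1 (u := fun n => (n : ℝ) ^ 2) (v := fun n => -(n : ℝ) ^ 2)
    (decA h0 h1) (decA h0 h1).sq (decB h0 h1) dv
  have e1 : ∑' n : ℤ, (-(n : ℝ) ^ 2) * (sg n * q ^ (n ^ 2)) = - B2 q := by
    rw [B2, ← tsum_neg]; congr 1; funext n; ring
  have H2 := H.tsum_eq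
  rw [tsum_split H.summable, e1] at H2
  have a1 : ∀ s t : ℤ, (((s + t : ℤ) : ℝ) ^ 2 + -((s - t : ℤ) : ℝ) ^ 2) *
      (q ^ ((s + t) ^ 2) * (sg (s - t) * q ^ ((s - t) ^ 2)))
      = (2 * s * (sg s * (q ^ 2) ^ (s ^ 2))) * (2 * t * (sg t * (q ^ 2) ^ (t ^ 2))) := by
    intro s t
    have : q ^ ((s + t) ^ 2) * q ^ ((s - t) ^ 2) = (q ^ 2) ^ s ^ 2 * (q ^ 2) ^ t ^ 2 := by
      rw [sqz, sqz, ← zpow_add₀ h0.ne', ← zpow_add₀ h0.ne']; congr 1; ring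
    rw [sg_sub]
    push_cast
    linear_combination 4 * s * t * (sg s * sg t) * this
  have a2 : ∀ s t : ℤ, (((s + t + 1 : ℤ) : ℝ) ^ 2 + -((s - t : ℤ) : ℝ) ^ 2) *
      (q ^ ((s + t + 1) ^ 2) * (sg (s - t) * q ^ ((s - t) ^ 2)))
      = q * ((sg s * (2 * s + 1) * (q ^ 2) ^ (s ^ 2 + s)) *
        (sg t * (2 * t + 1) * (q ^ 2) ^ (t ^ 2 + t))) := by
    intro s t
    have : q ^ ((s + t + 1) ^ 2) * q ^ ((s - t) ^ 2)
          = q * (q ^ 2) ^ (s ^ 2 + s) * (q ^ 2) ^ (t ^ 2 + t) := by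
        rw [sqz, sqz, mul_assoc, ← zpow_add₀ h0.ne', ← zpow_add₀ h0.ne', ← zpow_one_add₀ h0.ne']
        congr 1; ring
    rw [sg_sub]
    push_cast
    linear_combination (2 * s + 1) * (2 * t + 1) * (sg s * sg t) * this
  simp_rw [a1, a2] at H2
  have d3 : Dec fun s : ℤ => 2 * s * (sg s * (q ^ 2) ^ (s ^ 2)) :=
    ((decB k0 k1).mul_id.const_mul 2).congr fun n => by ring
  rw [tsum_mul_left, ← d3.tsum_mul d3, ← (decjj k0 k1).tsum_mul (decjj k0 k1)] at H2
  have z : ∑' s : ℤ, 2 * (s : ℝ) * (sg s * (q ^ 2) ^ (s ^ 2)) = 0 := by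
    apply tsum_refl_zero 0
    intro n
    rw [zero_sub, sg_neg, neg_sq]; push_cast; ring
  rw [z] at H2
  simp only [A2, thA, thB, jj]
  linear_combination -H2

end

end Rep


namespace Rep
open Filter Topology

lemma hs_congr {ι : Type*} {f g : ι → ℝ} {a b : ℝ} (h : HasSum f a) (hf : ∀ n, g n = f n)
    (hb : b = a) : HasSum g b := by
  rw [hb, funext hf]; exact h

lemma td_congr {f g : ℕ → ℝ} {a b : ℝ} (h : Tendsto f atTop (𝓝 a)) (hf : ∀ n, g n = f n)
    (hb : b = a) : Tendsto g atTop (𝓝 b) := by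
  rw [hb, funext hf]; exact h

lemma prod_lim {f : ℕ → ℝ} (hf : Summable f) (hp : ∀ i, 0 < 1 + f i) :
    Tendsto (fun N => ∏ k ∈ Finset.range N, (1 + f k)) atTop (𝓝 (∏' k, (1 + f k))) ∧
      0 < ∏' k, (1 + f k) := by
  refine ⟨(Real.multipliable_one_add_of_summable hf).tendsto_prod_tprod_nat, ?_⟩
  rw [← Real.rexp_tsum_eq_tprod hp (Real.summable_log_one_add_of_summable hf)]
  exact Real.exp_pos _

/-- Finite product `(Q²;Q²)_m`. -/
noncomputable def pp (Q : ℝ) (m : ℕ) : ℝ := ∏ k ∈ Finset.range m, (1 - Q ^ (2 * k + 2))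

/-- Reciprocal of the finite product, extended by zero. -/
noncomputable def rr (Q : ℝ) (m : ℤ) : ℝ := if m < 0 then 0 else 1 / pp Q m.toNat

section
variable {Q : ℝ}

lemma one_sub_pos (h0 : 0 < Q) (h1 : Q < 1) (k : ℕ) : 0 < 1 - Q ^ (k + 1) :=
  sub_pos.2 (pow_lt_one₀ h0.le h1 (by omega))

lemma pp_pos (h0 : 0 < Q) (h1 : Q < 1) (m : ℕ) : 0 < pp Q m :=
  Finset.prod_pos fun k _ => one_sub_pos h0 h1 (2 * k + 1)

lemma rr_rec (h0 : 0 < Q) (h1 : Q < 1) (m : ℤ) :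
    rr Q (m - 1) = (1 - Q ^ (2 * m)) * rr Q m := by
  rcases lt_trichotomy m 0 with h | h | h
  · simp [rr, h, show m - 1 < 0 by omega]
  · subst h; simp [rr]
  · obtain ⟨k, rfl⟩ : ∃ k : ℕ, m = k + 1 := ⟨(m - 1).toNat, by omega⟩
    have : ¬ ((k : ℤ) + 1 < 0) := by omega
    have e : ((k : ℤ) + 1).toNat = k + 1 := by omega
    simp only [rr, this, if_false, add_sub_cancel_right, e, Int.toNat_natCast,
      show ¬ ((k : ℤ) < 0) by omega]
    have h3 : pp Q (k + 1) = pp Q k * (1 - Q ^ (2 * k + 2)) := by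
      rw [pp, Finset.prod_range_succ, ← pp]
    have h4 : Q ^ (2 * ((k : ℤ) + 1)) = Q ^ (2 * k + 2) := by
      rw [← zpow_natCast]; push_cast; congr 1
    have h5 := (one_sub_pos h0 h1 (2 * k + 1)).ne'
    have h6 := (pp_pos h0 h1 k).ne'
    rw [h3, h4]
    have : 1 - Q ^ (2 * k + 2) ≠ 0 := h5
    field_simp

/-- Coefficients of the finite triple product. -/
noncomputable def dd (Q : ℝ) (N : ℕ) (j : ℤ) : ℝ :=
  pp Q (2 * N) * rr Q (N - j) * rr Q (N + j) * Q ^ (j ^ 2)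

lemma dd_rec (h0 : 0 < Q) (h1 : Q < 1) (N : ℕ) (j : ℤ) :
    dd Q (N + 1) j = (1 + Q ^ (4 * N + 2)) * dd Q N j
      + Q ^ (2 * N + 1) * (dd Q N (j - 1) + dd Q N (j + 1)) := by
  have hQ := h0.ne'
  have e1 : pp Q (2 * (N + 1)) = pp Q (2 * N) * (1 - Q ^ (4 * N + 2)) * (1 - Q ^ (4 * N + 4)) := by
    rw [show 2 * (N + 1) = 2 * N + 1 + 1 by ring, pp, Finset.prod_range_succ,
      Finset.prod_range_succ, ← pp]
    rw [show 2 * (2 * N) + 2 = 4 * N + 2 by ring, show 2 * (2 * N + 1) + 2 = 4 * N + 4 by ring]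
  have r1 := rr_rec h0 h1 (N + 1 - j)
  have r2 := rr_rec h0 h1 (N + 1 + j)
  have r3 := rr_rec h0 h1 (N - j)
  have r4 := rr_rec h0 h1 (N + j)
  rw [show (N : ℤ) + 1 - j - 1 = N - j by ring] at r1
  rw [show (N : ℤ) + 1 + j - 1 = N + j by ring] at r2
  simp only [dd]
  rw [e1, show (N : ℤ) - (j - 1) = N + 1 - j by ring, show (N : ℤ) + (j - 1) = N + j - 1 by ring,
    show (N : ℤ) - (j + 1) = N - j - 1 by ring, show (N : ℤ) + (j + 1) = N + 1 + j by ring, r4, r3,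
    r1, r2]
  push_cast
  have z1 : Q ^ (2 * ((N : ℤ) + 1 - j)) = Q ^ (2 * N) * Q ^ 2 / Q ^ (2 * j) := by
    rw [show 2 * ((N : ℤ) + 1 - j) = ((2 * N : ℕ) : ℤ) + 2 - 2 * j by push_cast; ring,
      zpow_sub₀ hQ, zpow_add₀ hQ, zpow_natCast]; norm_cast
  have z2 : Q ^ (2 * ((N : ℤ) + 1 + j)) = Q ^ (2 * N) * Q ^ 2 * Q ^ (2 * j) := by
    rw [show 2 * ((N : ℤ) + 1 + j) = ((2 * N : ℕ) : ℤ) + 2 + 2 * j by push_cast; ring,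
      zpow_add₀ hQ, zpow_add₀ hQ, zpow_natCast]; norm_cast
  have z3 : Q ^ (2 * ((N : ℤ) - j)) = Q ^ (2 * N) / Q ^ (2 * j) := by
    rw [show 2 * ((N : ℤ) - j) = ((2 * N : ℕ) : ℤ) - 2 * j by push_cast; ring,
      zpow_sub₀ hQ, zpow_natCast]
  have z4 : Q ^ (2 * ((N : ℤ) + j)) = Q ^ (2 * N) * Q ^ (2 * j) := by
    rw [show 2 * ((N : ℤ) + j) = ((2 * N : ℕ) : ℤ) + 2 * j by push_cast; ring,
      zpow_add₀ hQ, zpow_natCast]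
  have z5 : Q ^ ((j - 1) ^ 2) = Q ^ (j ^ 2) * Q / Q ^ (2 * j) := by
    rw [show (j - 1) ^ 2 = j ^ 2 + 1 - 2 * j by ring, zpow_sub₀ hQ, zpow_add₀ hQ, zpow_one]
  have z6 : Q ^ ((j + 1) ^ 2) = Q ^ (j ^ 2) * Q * Q ^ (2 * j) := by
    rw [show (j + 1) ^ 2 = j ^ 2 + 1 + 2 * j by ring, zpow_add₀ hQ, zpow_add₀ hQ, zpow_one]
  rw [z1, z2, z3, z4, z5, z6]
  have hZ : Q ^ (2 * j) ≠ 0 := zpow_ne_zero _ hQ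
  generalize Q ^ (2 * j) = Z at *
  have y1 : Q ^ (4 * N + 2) = (Q ^ (2 * N)) ^ 2 * Q ^ 2 := by ring
  have y2 : Q ^ (4 * N + 4) = (Q ^ (2 * N)) ^ 2 * Q ^ 4 := by ring
  have y3 : Q ^ (2 * N + 1) = Q ^ (2 * N) * Q := by ring
  rw [y1, y2, y3]
  generalize Q ^ (2 * N) = Y at *
  field_simp
  ring

/-- Finite triple product. -/
noncomputable def PN (Q x : ℝ) (N : ℕ) : ℝ :=
  ∏ k ∈ Finset.range N, ((1 + x * Q ^ (2 * k + 1)) * (1 + x⁻¹ * Q ^ (2 * k + 1)))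

lemma hasSum_shift {f : ℤ → ℝ} {a : ℝ} (h : HasSum f a) (c : ℤ) :
    HasSum (fun n => f (n + c)) a := (Equiv.addRight c).hasSum_iff.2 h

lemma dd_zero (j : ℤ) (hj : j ≠ 0) : dd Q 0 j = 0 := by
  rcases lt_or_gt_of_ne hj with h | h
  · simp [dd, rr, h]
  · simp [dd, rr, h]

lemma finite_jtp (h0 : 0 < Q) (h1 : Q < 1) {x : ℝ} (hx : x ≠ 0) (N : ℕ) :
    HasSum (fun j : ℤ => dd Q N j * x ^ j) (PN Q x N) := by
  induction N with
  | zero =>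
    have := hasSum_single (f := fun j : ℤ => dd Q 0 j * x ^ j) 0 (fun j hj => by
      simp [dd_zero j hj])
    simpa [dd, rr, pp, PN] using this
  | succ N ih =>
    have s1 := (hasSum_shift ih (-1)).mul_left (Q ^ (2 * N + 1) * x)
    have s2 := (hasSum_shift ih 1).mul_left (Q ^ (2 * N + 1) * x⁻¹)
    have s := ((ih.mul_left (1 + Q ^ (4 * N + 2))).add s1).add s2
    refine hs_congr s (fun j => ?_) ?_
    · rw [dd_rec h0 h1, ← sub_eq_add_neg, zpow_add₀ hx, zpow_sub₀ hx, zpow_one]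
      field_simp
      ring
    · rw [PN, Finset.prod_range_succ, ← PN]
      field_simp
      ring

lemma finite_jac (h0 : 0 < Q) (h1 : Q < 1) (N : ℕ) :
    HasSum (fun j : ℤ => (j : ℝ) * (dd Q (N + 1) j * (-Q) ^ j)) (pp Q (N + 1) * pp Q N) := by
  have hx : (-Q) ≠ 0 := by linarith
  have key : ∀ N : ℕ, ∀ D : ℝ, HasSum (fun j : ℤ => (j : ℝ) * (dd Q N j * (-Q) ^ j)) D →
      HasSum (fun j : ℤ => (j : ℝ) * (dd Q (N + 1) j * (-Q) ^ j))
        (D * (1 - Q ^ (2 * N + 2)) * (1 - Q ^ (2 * N))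
          + PN Q (-Q) N * (Q ^ (2 * N) - Q ^ (2 * N + 2))) := by
    intro N D ih
    have ip := finite_jtp h0 h1 hx N
    have s1 := (hasSum_shift (ih.add ip) (-1)).mul_left (Q ^ (2 * N + 1) * (-Q))
    have s2 := (hasSum_shift (ih.sub ip) 1).mul_left (Q ^ (2 * N + 1) * (-Q)⁻¹)
    have s := ((ih.mul_left (1 + Q ^ (4 * N + 2))).add s1).add s2
    refine hs_congr s (fun j => ?_) ?_
    · rw [dd_rec h0 h1, ← sub_eq_add_neg, zpow_add₀ hx, zpow_sub₀ hx, zpow_one]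
      push_cast
      field_simp
      ring
    · field_simp
      ring
  induction N with
  | zero =>
    have := key 0 0 (by
      have := hasSum_single (f := fun j : ℤ => (j : ℝ) * (dd Q 0 j * (-Q) ^ j)) 0 (fun j hj => by
        simp [dd_zero j hj])
      simpa using this)
    simpa [pp, PN] using this
  | succ N ih =>
    have hP : PN Q (-Q) (N + 1) = 0 := by
      rw [PN, Finset.prod_range_succ']
      simp [h0.ne']
    have := key _ _ ih
    rw [hP] at this
    convert this using 1
    have e1 : pp Q (N + 1 + 1) = pp Q (N + 1) * (1 - Q ^ (2 * (N + 1) + 2)) := by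
      rw [pp, Finset.prod_range_succ, ← pp]
    have e2 : pp Q (N + 1) = pp Q N * (1 - Q ^ (2 * (N + 1))) := by
      rw [pp, Finset.prod_range_succ, ← pp]; congr 2
    rw [e1]
    nth_rewrite 2 [e2]
    ring

/-- The Euler product. -/
noncomputable def EE (q : ℝ) : ℝ := ∏' k : ℕ, (1 - q ^ (k + 1))

lemma summable_neg_pow (h0 : 0 < Q) (h1 : Q < 1) (a b : ℕ) (c : ℝ) (ha : a ≠ 0) :
    Summable fun k : ℕ => c * Q ^ (a * k + b) := by
  have := (summable_geometric_of_lt_one (pow_nonneg h0.le a) (pow_lt_one₀ h0.le h1 ha)).mul_left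
    (c * Q ^ b)
  refine this.congr fun k => ?_
  rw [pow_add, pow_mul]; ring

lemma EE_lim (h0 : 0 < Q) (h1 : Q < 1) :
    Tendsto (fun N => ∏ k ∈ Finset.range N, (1 - Q ^ (k + 1))) atTop (𝓝 (EE Q)) ∧ 0 < EE Q := by
  have := prod_lim (f := fun k => -1 * Q ^ (1 * k + 1)) (summable_neg_pow h0 h1 1 1 (-1) one_ne_zero)
    (fun i => by have := one_sub_pos h0 h1 i; simpa [← sub_eq_add_neg])
  simpa [← sub_eq_add_neg, EE] using this

lemma pp_eq (m : ℕ) : pp Q m = ∏ k ∈ Finset.range m, (1 - (Q ^ 2) ^ (k + 1)) := by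
  rw [pp]
  refine Finset.prod_congr rfl fun k _ => ?_
  rw [← pow_mul]; congr 2

lemma pp_lim (h0 : 0 < Q) (h1 : Q < 1) : Tendsto (pp Q) atTop (𝓝 (EE (Q ^ 2))) := by
  obtain ⟨k0, k1⟩ := sq_lt_one h0 h1
  refine (EE_lim k0 k1).1.congr fun m => (pp_eq m).symm

lemma pp_anti (h0 : 0 < Q) (h1 : Q < 1) : Antitone (pp Q) := by
  refine antitone_nat_of_succ_le fun n => ?_
  rw [pp, Finset.prod_range_succ, ← pp]
  have : 0 < Q ^ (2 * n + 2) := by positivity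
  nlinarith [pp_pos h0 h1 n]

lemma EE_le_pp (h0 : 0 < Q) (h1 : Q < 1) (m : ℕ) : EE (Q ^ 2) ≤ pp Q m :=
  (pp_anti h0 h1).le_of_tendsto (pp_lim h0 h1) m

lemma rr_nonneg (h0 : 0 < Q) (h1 : Q < 1) (m : ℤ) : 0 ≤ rr Q m := by
  rw [rr]; split_ifs
  · exact le_rfl
  · exact (one_div_pos.2 (pp_pos h0 h1 _)).le

lemma rr_le (h0 : 0 < Q) (h1 : Q < 1) (m : ℤ) : rr Q m ≤ 1 / EE (Q ^ 2) := by
  obtain ⟨k0, k1⟩ := sq_lt_one h0 h1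
  rw [rr]; split_ifs
  · exact (one_div_pos.2 (EE_lim k0 k1).2).le
  · exact one_div_le_one_div_of_le (EE_lim k0 k1).2 (EE_le_pp h0 h1 _)

lemma rr_lim (h0 : 0 < Q) (h1 : Q < 1) (j : ℤ) :
    Tendsto (fun N : ℕ => rr Q (N + j)) atTop (𝓝 (1 / EE (Q ^ 2))) := by
  obtain ⟨k0, k1⟩ := sq_lt_one h0 h1
  have t : Tendsto (fun N : ℕ => ((N : ℤ) + j).toNat) atTop atTop := by
    rw [tendsto_atTop]
    intro b
    filter_upwards [eventually_ge_atTop (b + j.natAbs)] with N hN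
    omega
  have := (tendsto_const_nhds (x := (1 : ℝ))).div ((pp_lim h0 h1).comp t) (EE_lim k0 k1).2.ne'
  refine this.congr' ?_
  filter_upwards [eventually_ge_atTop j.natAbs] with N hN
  simp only [Function.comp, rr, Pi.div_apply]
  rw [if_neg (by omega)]

lemma dd_lim (h0 : 0 < Q) (h1 : Q < 1) (j : ℤ) :
    Tendsto (fun N : ℕ => dd Q N j) atTop (𝓝 (1 / EE (Q ^ 2) * Q ^ (j ^ 2))) := by
  obtain ⟨k0, k1⟩ := sq_lt_one h0 h1
  have t : Tendsto (fun N : ℕ => 2 * N) atTop atTop :=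
    tendsto_id.const_mul_atTop' (by norm_num)
  have := ((((pp_lim h0 h1).comp t).mul (rr_lim h0 h1 (-j))).mul (rr_lim h0 h1 j)).mul_const
    (Q ^ (j ^ 2))
  refine td_congr this (fun N => by simp [dd, sub_eq_add_neg]) ?_
  have := (EE_lim k0 k1).2.ne'
  field_simp

lemma dd_bound (h0 : 0 < Q) (h1 : Q < 1) (N : ℕ) (j : ℤ) :
    |dd Q N j| ≤ (1 / EE (Q ^ 2)) ^ 2 * Q ^ (j ^ 2) := by
  have p1 : pp Q (2 * N) ≤ 1 := by
    have := pp_anti h0 h1 (Nat.zero_le (2 * N)); simpa [pp] using this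
  have p0 := pp_pos h0 h1 (2 * N)
  have a0 := rr_nonneg h0 h1 (N - j)
  have b0 := rr_nonneg h0 h1 (N + j)
  have a1 := rr_le h0 h1 (N - j)
  have b1 := rr_le h0 h1 (N + j)
  rw [abs_of_nonneg (by rw [dd]; positivity), dd]
  have c0 : 0 ≤ 1 / EE (Q ^ 2) := a0.trans a1
  apply mul_le_mul_of_nonneg_right _ (by positivity)
  calc pp Q (2 * N) * rr Q (N - j) * rr Q (N + j)
      ≤ 1 * (1 / EE (Q ^ 2)) * (1 / EE (Q ^ 2)) := by gcongr
    _ = _ := by ring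

/-- Jacobi triple product, limit form. -/
lemma jtp (h0 : 0 < Q) (h1 : Q < 1) {x : ℝ} (hx : x ≠ 0)
    (hs : Summable fun j : ℤ => Q ^ (j ^ 2) * |x| ^ j) :
    Tendsto (PN Q x) atTop (𝓝 (1 / EE (Q ^ 2) * ∑' j : ℤ, Q ^ (j ^ 2) * x ^ j)) := by
  have := tendsto_tsum_of_dominated_convergence (𝓕 := atTop)
    (f := fun (N : ℕ) (j : ℤ) => dd Q N j * x ^ j)
    (g := fun j : ℤ => 1 / EE (Q ^ 2) * (Q ^ (j ^ 2) * x ^ j)) (hs.mul_left ((1 / EE (Q ^ 2)) ^ 2))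
    (fun j => by
      have := (dd_lim h0 h1 j).mul_const (x ^ j)
      simpa [mul_assoc] using this)
    (Eventually.of_forall fun N j => by
      rw [Real.norm_eq_abs, abs_mul, abs_zpow, ← mul_assoc]
      exact mul_le_mul_of_nonneg_right (dd_bound h0 h1 N j) (by positivity))
  rw [tsum_mul_left] at this
  exact this.congr fun N => (finite_jtp h0 h1 hx N).tsum_eq

lemma jac_cube (h0 : 0 < Q) (h1 : Q < 1) : jj Q = 2 * EE (Q ^ 2) ^ 3 := by
  obtain ⟨k0, k1⟩ := sq_lt_one h0 h1
  have e0 : ∀ j : ℤ, Q ^ (j ^ 2) * (-Q) ^ j = sg j * Q ^ (j ^ 2 + j) := fun j => by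
    rw [neg_eq_neg_one_mul, mul_zpow, ← sg, zpow_add₀ h0.ne']; ring
  have d := (decPsi' h0 h1).mul_id
  have := tendsto_tsum_of_dominated_convergence (𝓕 := atTop)
    (f := fun (N : ℕ) (j : ℤ) => (j : ℝ) * (dd Q (N + 1) j * (-Q) ^ j))
    (g := fun j : ℤ => 1 / EE (Q ^ 2) * ((j : ℝ) * (sg j * Q ^ (j ^ 2 + j))))
    (d.summable.norm.mul_left ((1 / EE (Q ^ 2)) ^ 2))
    (fun j => by
      have := (((dd_lim h0 h1 j).comp (tendsto_add_atTop_nat 1)).mul_const ((-Q) ^ j)).const_mul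
        (j : ℝ)
      rw [mul_assoc, e0] at this
      exact td_congr this (fun N => by simp) (by ring))
    (Eventually.of_forall fun N j => by
      rw [Real.norm_eq_abs, Real.norm_eq_abs, abs_mul, abs_mul, abs_mul, ← e0, abs_mul,
        abs_of_pos (show 0 < Q ^ (j ^ 2) by positivity)]
      have := mul_le_mul_of_nonneg_right (dd_bound h0 h1 (N + 1) j)
        (show 0 ≤ |(j : ℝ)| * |(-Q) ^ j| by positivity)
      calc _ = _ := by ring
        _ ≤ _ := this
        _ = _ := by ring)
  rw [tsum_mul_left] at this
  have h2 := this.congr fun N => (finite_jac h0 h1 N).tsum_eq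
  have h3 := ((pp_lim h0 h1).comp (tendsto_add_atTop_nat 1)).mul (pp_lim h0 h1)
  have h4 := tendsto_nhds_unique h2 h3
  have h5 : jj Q = 2 * ∑' j : ℤ, (j : ℝ) * (sg j * Q ^ (j ^ 2 + j)) := by
    have h6 : jj Q = ∑' j : ℤ, (2 * ((j : ℝ) * (sg j * Q ^ (j ^ 2 + j))) + sg j * Q ^ (j ^ 2 + j)) := by
      rw [jj]; congr 1; funext j; ring
    rw [h6, (d.summable.mul_left 2).tsum_add (decPsi' h0 h1).summable, sum_psi_alt, tsum_mul_left,
      add_zero]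
  rw [h5]
  have := (EE_lim k0 k1).2.ne'
  rw [one_div, inv_mul_eq_iff_eq_mul₀ this] at h4
  linear_combination 2 * h4

end

end Rep


namespace Rep
open Filter Topology

noncomputable def OO (q : ℝ) : ℝ := ∏' k : ℕ, (1 - q ^ (2 * k + 1))
noncomputable def Op (q : ℝ) : ℝ := ∏' k : ℕ, (1 + q ^ (2 * k + 1))
noncomputable def Ep (q : ℝ) : ℝ := ∏' k : ℕ, (1 + q ^ (2 * k + 2))

section
variable {q : ℝ}

lemma OO_lim (h0 : 0 < q) (h1 : q < 1) :
    Tendsto (fun N => ∏ k ∈ Finset.range N, (1 - q ^ (2 * k + 1))) atTop (𝓝 (OO q)) ∧ 0 < OO q := by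
  have := prod_lim (f := fun k => -1 * q ^ (2 * k + 1)) (summable_neg_pow h0 h1 2 1 (-1) two_ne_zero)
    (fun i => by have := one_sub_pos h0 h1 (2 * i); simpa [← sub_eq_add_neg])
  simpa [← sub_eq_add_neg, OO] using this

lemma Op_lim (h0 : 0 < q) (h1 : q < 1) :
    Tendsto (fun N => ∏ k ∈ Finset.range N, (1 + q ^ (2 * k + 1))) atTop (𝓝 (Op q)) ∧ 0 < Op q := by
  have := prod_lim (f := fun k => 1 * q ^ (2 * k + 1)) (summable_neg_pow h0 h1 2 1 1 two_ne_zero)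
    (fun i => by positivity)
  simpa [Op] using this

lemma Ep_lim (h0 : 0 < q) (h1 : q < 1) :
    Tendsto (fun N => ∏ k ∈ Finset.range N, (1 + q ^ (2 * k + 2))) atTop (𝓝 (Ep q)) ∧ 0 < Ep q := by
  have := prod_lim (f := fun k => 1 * q ^ (2 * k + 2)) (summable_neg_pow h0 h1 2 2 1 two_ne_zero)
    (fun i => by positivity)
  simpa [Ep] using this

lemma OE (h0 : 0 < q) (h1 : q < 1) : OO q * EE (q ^ 2) = EE q := by
  have t : Tendsto (fun N : ℕ => 2 * N) atTop atTop :=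
    tendsto_id.const_mul_atTop' (by norm_num)
  refine tendsto_nhds_unique ((OO_lim h0 h1).1.mul (pp_lim h0 h1)) ?_
  refine ((EE_lim h0 h1).1.comp t).congr fun N => ?_
  simp only [Function.comp, pp]
  induction N with
  | zero => simp
  | succ N ih =>
    rw [show 2 * (N + 1) = 2 * N + 1 + 1 by ring, Finset.prod_range_succ, Finset.prod_range_succ, ih,
      Finset.prod_range_succ, Finset.prod_range_succ]
    ring

lemma OOp (h0 : 0 < q) (h1 : q < 1) : Op q * OO q = OO (q ^ 2) := by
  obtain ⟨k0, k1⟩ := sq_lt_one h0 h1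
  refine tendsto_nhds_unique ((Op_lim h0 h1).1.mul (OO_lim h0 h1).1) ?_
  refine (OO_lim k0 k1).1.congr fun N => ?_
  rw [← Finset.prod_mul_distrib]
  exact Finset.prod_congr rfl fun k _ => by ring

lemma EpE (h0 : 0 < q) (h1 : q < 1) : Ep q * EE (q ^ 2) = EE (q ^ 4) := by
  obtain ⟨k0, k1⟩ := q4_lt_one h0 h1
  refine tendsto_nhds_unique ((Ep_lim h0 h1).1.mul (pp_lim h0 h1)) ?_
  refine (EE_lim k0 k1).1.congr fun N => ?_
  rw [pp, ← Finset.prod_mul_distrib]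
  exact Finset.prod_congr rfl fun k _ => by ring

lemma A_prod (h0 : 0 < q) (h1 : q < 1) : thA q = EE (q ^ 2) * Op q ^ 2 := by
  obtain ⟨k0, k1⟩ := sq_lt_one h0 h1
  have := jtp h0 h1 (x := 1) one_ne_zero (by simpa using (decA h0 h1).summable)
  have h2 := tendsto_nhds_unique this (td_congr ((Op_lim h0 h1).1.pow 2) (fun N => by
    rw [PN, ← Finset.prod_pow]
    exact Finset.prod_congr rfl fun k _ => by ring) rfl)
  simp only [one_zpow, mul_one] at h2
  rw [← thA] at h2
  rwa [one_div, inv_mul_eq_iff_eq_mul₀ (EE_lim k0 k1).2.ne'] at h2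

lemma B_prod (h0 : 0 < q) (h1 : q < 1) : thB q = EE (q ^ 2) * OO q ^ 2 := by
  obtain ⟨k0, k1⟩ := sq_lt_one h0 h1
  have := jtp h0 h1 (x := -1) (by norm_num) (by simpa using (decA h0 h1).summable)
  have h2 := tendsto_nhds_unique this (td_congr ((OO_lim h0 h1).1.pow 2) (fun N => by
    rw [PN, ← Finset.prod_pow]
    exact Finset.prod_congr rfl fun k _ => by rw [inv_neg_one]; ring) rfl)
  rw [one_div, inv_mul_eq_iff_eq_mul₀ (EE_lim k0 k1).2.ne'] at h2
  rw [← h2, thB]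
  exact tsum_congr fun n => by rw [sg, mul_comm]

lemma Psi_prod (h0 : 0 < q) (h1 : q < 1) : Psi q = 2 * EE (q ^ 2) * Ep q ^ 2 := by
  obtain ⟨k0, k1⟩ := sq_lt_one h0 h1
  have e : ∀ n : ℤ, q ^ (n ^ 2) * q ^ n = q ^ (n ^ 2 + n) := fun n => (zpow_add₀ h0.ne' _ _).symm
  have := jtp h0 h1 (x := q) h0.ne' (by
    rw [abs_of_pos h0]; simp_rw [e]; exact (decPsi h0 h1).summable)
  have h3 := ((Ep_lim h0 h1).1.comp (tendsto_add_atTop_nat 1)).mul ((Ep_lim h0 h1).1.const_mul 2)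
  have h2 := tendsto_nhds_unique (this.comp (tendsto_add_atTop_nat 1))
    (td_congr h3 (fun N => by
      simp only [Function.comp, PN]
      rw [Finset.prod_mul_distrib]
      congr 1
      · exact Finset.prod_congr rfl fun k _ => by ring
      · rw [Finset.prod_range_succ', mul_comm]
        congr 1
        · rw [mul_zero, zero_add, pow_one, inv_mul_cancel₀ h0.ne']; norm_num
        · exact Finset.prod_congr rfl fun k _ => by field_simp; ring) rfl)
  rw [one_div, inv_mul_eq_iff_eq_mul₀ (EE_lim k0 k1).2.ne'] at h2
  simp_rw [e] at h2
  rw [← Psi] at h2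
  rw [h2]; ring

lemma hh_nonneg (h0 : 0 < q) (h1 : q < 1) : 0 ≤ hh q := by
  obtain ⟨k0, k1⟩ := sq_lt_one h0 h1
  obtain ⟨l0, l1⟩ := sq_lt_one k0 k1
  have hq : |(-q)| = q := by rw [abs_neg, abs_of_pos h0]
  have := jtp k0 k1 (x := -q) (by linarith) (by
    rw [hq]
    refine (dec_q h0 h1 2 1 0 (by norm_num)).summable.congr fun n => ?_
    rw [sqz, ← zpow_add₀ h0.ne', add_zero, one_mul])
  have h2 : 0 ≤ 1 / EE ((q ^ 2) ^ 2) * ∑' j : ℤ, (q ^ 2) ^ (j ^ 2) * (-q) ^ j := by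
    refine ge_of_tendsto' this fun N => ?_
    rw [PN]
    refine Finset.prod_nonneg fun k _ => ?_
    have a : q ^ (4 * k + 3) < 1 := pow_lt_one₀ h0.le h1 (by omega)
    have b : q ^ (4 * k + 1) < 1 := pow_lt_one₀ h0.le h1 (by omega)
    have e1 : 1 + -q * (q ^ 2) ^ (2 * k + 1) = 1 - q ^ (4 * k + 3) := by ring
    have e2 : 1 + (-q)⁻¹ * (q ^ 2) ^ (2 * k + 1) = 1 - q ^ (4 * k + 1) := by
      field_simp; ring
    rw [e1, e2]
    exact mul_nonneg (by linarith) (by linarith)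
  have h3 := (EE_lim l0 l1).2
  have h4 : hh q = ∑' j : ℤ, (q ^ 2) ^ (j ^ 2) * (-q) ^ j := by
    rw [hh]
    refine tsum_congr fun n => ?_
    rw [neg_eq_neg_one_mul q, mul_zpow, ← sg, sqz, zpow_add₀ h0.ne']; ring
  rw [h4]
  exact nonneg_of_mul_nonneg_right h2 (by positivity)

lemma A_pos (h0 : 0 < q) (h1 : q < 1) : 0 < thA q := by
  obtain ⟨k0, k1⟩ := sq_lt_one h0 h1
  rw [A_prod h0 h1]
  have := (EE_lim k0 k1).2
  have := (Op_lim h0 h1).2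
  positivity
lemma B_pos (h0 : 0 < q) (h1 : q < 1) : 0 < thB q := by
  obtain ⟨k0, k1⟩ := sq_lt_one h0 h1
  rw [B_prod h0 h1]
  have := (EE_lim k0 k1).2
  have := (OO_lim h0 h1).2
  positivity
lemma Psi_pos (h0 : 0 < q) (h1 : q < 1) : 0 < Psi q := by
  obtain ⟨k0, k1⟩ := sq_lt_one h0 h1
  rw [Psi_prod h0 h1]
  have := (EE_lim k0 k1).2
  have := (Ep_lim h0 h1).2
  positivity
lemma hh_pos (h0 : 0 < q) (h1 : q < 1) : 0 < hh q := by
  refine lt_of_le_of_ne (hh_nonneg h0 h1) fun h => ?_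
  have := hh_sq h0 h1
  rw [← h] at this
  have := mul_pos (Psi_pos h0 h1) (B_pos h0 h1)
  linarith

lemma sq_sq : (q ^ 2) ^ 2 = q ^ 4 := by ring

lemma B_E (h0 : 0 < q) (h1 : q < 1) : thB q * EE (q ^ 2) = EE q ^ 2 := by
  rw [B_prod h0 h1, ← OE h0 h1]; ring

lemma A_E (h0 : 0 < q) (h1 : q < 1) :
    thA q * EE q ^ 2 * EE (q ^ 4) ^ 2 = EE (q ^ 2) ^ 5 := by
  obtain ⟨k0, k1⟩ := sq_lt_one h0 h1
  have e := OE k0 k1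
  rw [sq_sq] at e
  rw [A_prod h0 h1, ← OE h0 h1]
  have := OOp h0 h1
  calc _ = (Op q * OO q) ^ 2 * EE (q ^ 4) ^ 2 * EE (q ^ 2) ^ 3 := by ring
    _ = (OO (q ^ 2) * EE (q ^ 4)) ^ 2 * EE (q ^ 2) ^ 3 := by rw [this]; ring
    _ = _ := by rw [e]; ring

lemma Psi_E (h0 : 0 < q) (h1 : q < 1) : Psi q * EE (q ^ 2) = 2 * EE (q ^ 4) ^ 2 := by
  rw [Psi_prod h0 h1, ← EpE h0 h1]; ring

lemma jacobi (h0 : 0 < q) (h1 : q < 1) : jj q = Psi q * thA q * thB q := by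
  obtain ⟨k0, k1⟩ := sq_lt_one h0 h1
  obtain ⟨l0, l1⟩ := q4_lt_one h0 h1
  have e1 := (EE_lim h0 h1).2
  have e2 := (EE_lim k0 k1).2
  have e4 := (EE_lim l0 l1).2
  have a := A_E h0 h1
  have b := B_E h0 h1
  have p := Psi_E h0 h1
  rw [jac_cube h0 h1]
  have h : thB q = EE q ^ 2 / EE (q ^ 2) := by field_simp; linarith
  have h' : thA q = EE (q ^ 2) ^ 5 / (EE q ^ 2 * EE (q ^ 4) ^ 2) := by field_simp; linarith
  have h'' : Psi q = 2 * EE (q ^ 4) ^ 2 / EE (q ^ 2) := by field_simp; linarith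
  rw [h, h', h'']
  field_simp

end

end Rep


namespace Rep
open Filter Topology

section
variable {q : ℝ}

lemma hd_congr {f : ℝ → ℝ} {d d' : ℝ} (h : HasDerivAt f d q) (e : d' = d) : HasDerivAt f d' q := by
  rw [e]; exact h

lemma theta_deriv {a : ℤ → ℝ} {e : ℤ → ℤ} (he : ∀ n, 0 ≤ e n)
    (hs : ∀ r : ℝ, 0 < r → r < 1 → Summable fun n => a n * r ^ (e n))
    (hs' : ∀ r : ℝ, 0 < r → r < 1 → Summable fun n => a n * e n * r ^ (e n))
    (h0 : 0 < q) (h1 : q < 1) :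
    HasDerivAt (fun q : ℝ => ∑' n, a n * q ^ (e n)) ((∑' n, a n * e n * q ^ (e n)) / q) q := by
  obtain ⟨r, hr, hr1⟩ := exists_between h1
  have hr0 : 0 < r := h0.trans hr
  have key := hasDerivAt_tsum_of_isPreconnected
    (g := fun (n : ℤ) (y : ℝ) => a n * y ^ (e n))
    (g' := fun (n : ℤ) (y : ℝ) => a n * (e n * y ^ (e n - 1)))
    (u := fun n => |a n * e n * r ^ (e n)| * (2 / q)) (t := Set.Ioo (q / 2) r) (y₀ := q) (y := q)
    ((hs' r hr0 hr1).abs.mul_right _) isOpen_Ioo isPreconnected_Ioo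
    (fun n y hy => (hasDerivAt_zpow (e n) y (Or.inl (by linarith [hy.1]))).const_mul _)
    (fun n y hy => by
      have hy0 : 0 < y := by linarith [hy.1]
      have he' : (0 : ℝ) ≤ e n := by exact_mod_cast he n
      rw [Real.norm_eq_abs, abs_mul, abs_mul, abs_mul, abs_mul, mul_assoc, mul_assoc]
      apply mul_le_mul_of_nonneg_left _ (abs_nonneg _)
      apply mul_le_mul_of_nonneg_left _ (abs_nonneg _)
      rw [zpow_sub₀ hy0.ne', zpow_one, abs_of_pos (by positivity), abs_of_pos (by positivity),
        div_eq_mul_inv]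
      have i1 : y ^ (e n) ≤ r ^ (e n) := by
        obtain ⟨k, hk⟩ := Int.eq_ofNat_of_zero_le (he n)
        rw [hk, zpow_natCast, zpow_natCast]
        exact pow_le_pow_left₀ hy0.le hy.2.le k
      have i2 : y⁻¹ ≤ 2 / q := by
        rw [inv_le_comm₀ hy0 (by positivity), inv_div]
        exact hy.1.le
      gcongr)
    ⟨by linarith, hr⟩ (hs q h0 h1) ⟨by linarith, hr⟩
  refine hd_congr key ?_
  rw [← tsum_div_const]
  refine tsum_congr fun n => ?_
  rw [zpow_sub₀ h0.ne', zpow_one]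
  ring

lemma derivA (h0 : 0 < q) (h1 : q < 1) : HasDerivAt thA (A2 q / q) q := by
  have := theta_deriv (a := fun _ => 1) (e := fun n => n ^ 2) (fun n => sq_nonneg n)
    (fun r r0 r1 => (decA r0 r1).summable.congr fun n => by ring)
    (fun r r0 r1 => (decA r0 r1).sq.summable.congr fun n => by push_cast; ring) h0 h1
  simp only [one_mul] at this
  refine hd_congr this ?_
  simp [A2]

lemma derivB (h0 : 0 < q) (h1 : q < 1) : HasDerivAt thB (B2 q / q) q := by
  have := theta_deriv (a := sg) (e := fun n => n ^ 2) (fun n => sq_nonneg n)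
    (fun r r0 r1 => (decB r0 r1).summable.congr fun n => by ring)
    (fun r r0 r1 => (decB r0 r1).sq.summable.congr fun n => by push_cast; ring) h0 h1
  refine hd_congr this ?_
  rw [B2]
  congr 1
  refine tsum_congr fun n => ?_
  push_cast; ring

lemma n_sq_add (n : ℤ) : 0 ≤ n ^ 2 + n := by
  rcases le_or_gt 0 n with h | h <;> nlinarith

lemma derivPsi (h0 : 0 < q) (h1 : q < 1) : ∃ d, HasDerivAt Psi d q := by
  have := theta_deriv (a := fun _ => 1) (e := fun n => n ^ 2 + n) n_sq_add
    (fun r r0 r1 => (decPsi r0 r1).summable.congr fun n => by ring)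
    (fun r r0 r1 => ((decPsi r0 r1).sq.add (decPsi r0 r1).mul_id).summable.congr fun n => by
      push_cast; ring) h0 h1
  simp only [one_mul] at this
  exact ⟨_, this⟩

/-- The cubic theta sum attached to `jj`. -/
noncomputable def st3 (q : ℝ) : ℝ := ∑' n : ℤ, sg n * (2 * n + 1) ^ 3 * q ^ (n ^ 2 + n)

lemma decjj3 (h0 : 0 < q) (h1 : q < 1) :
    Dec fun n : ℤ => sg n * (2 * n + 1) ^ 3 * q ^ (n ^ 2 + n) :=
  (((decjj h0 h1).mul_lin 2 1).mul_lin 2 1).congr fun n => by ring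

lemma derivjj (h0 : 0 < q) (h1 : q < 1) : HasDerivAt jj ((st3 q - jj q) / 4 / q) q := by
  have := theta_deriv (a := fun n => sg n * (2 * n + 1)) (e := fun n => n ^ 2 + n) n_sq_add
    (fun r r0 r1 => (decjj r0 r1).summable)
    (fun r r0 r1 => ((decjj r0 r1).sq.add (decjj r0 r1).mul_id).summable.congr fun n => by
      push_cast; ring) h0 h1
  refine hd_congr this ?_
  rw [st3, jj, ← (decjj3 h0 h1).summable.tsum_sub (decjj h0 h1).summable, ← tsum_div_const]
  congr 1
  refine tsum_congr fun n => ?_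
  push_cast; ring

noncomputable def s1 (q : ℝ) : ℝ := ∑' n : ℤ, sg n * (2 * n + 1) * q ^ ((2 * n + 1) ^ 2)
noncomputable def s3 (q : ℝ) : ℝ := ∑' n : ℤ, sg n * (2 * n + 1) ^ 3 * q ^ ((2 * n + 1) ^ 2)

lemma decs0 (h0 : 0 < q) (h1 : q < 1) : Dec fun n : ℤ => sg n * q ^ ((2 * n + 1) ^ 2) :=
  (dec_sq h0 h1 4 4 1 (by norm_num)).congr fun n => by congr 2; ring
lemma decs1 (h0 : 0 < q) (h1 : q < 1) : Dec fun n : ℤ => sg n * (2 * n + 1) * q ^ ((2 * n + 1) ^ 2) :=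
  ((decs0 h0 h1).mul_lin 2 1).congr fun n => by ring
lemma decs3 (h0 : 0 < q) (h1 : q < 1) :
    Dec fun n : ℤ => sg n * (2 * n + 1) ^ 3 * q ^ ((2 * n + 1) ^ 2) :=
  (((decs1 h0 h1).mul_lin 2 1).mul_lin 2 1).congr fun n => by ring

lemma derivs1 (h0 : 0 < q) (h1 : q < 1) : HasDerivAt s1 (s3 q / q) q := by
  have := theta_deriv (a := fun n => sg n * (2 * n + 1)) (e := fun n => (2 * n + 1) ^ 2)
    (fun n => sq_nonneg _)
    (fun r r0 r1 => (decs1 r0 r1).summable)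
    (fun r r0 r1 => (decs3 r0 r1).summable.congr fun n => by push_cast; ring) h0 h1
  refine hd_congr this ?_
  rw [s3]
  congr 1
  refine tsum_congr fun n => ?_
  push_cast; ring

lemma s1_eq (h0 : 0 < q) (h1 : q < 1) :
    s1 q = (thA q ^ 2 - thB q ^ 2) / 4 * thB (q ^ 4) := by
  obtain ⟨k0, k1⟩ := q4_lt_one h0 h1
  have e : s1 q = q * jj (q ^ 4) := by
    rw [s1, jj, ← tsum_mul_left]
    refine tsum_congr fun n => ?_
    rw [q4z, show (2 * n + 1) ^ 2 = 1 + 4 * (n ^ 2 + n) by ring, zpow_add₀ h0.ne', zpow_one]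
    ring
  rw [e, jacobi k0 k1, A_split h0 h1, B_split h0 h1]
  ring

lemma two_b_sq (h0 : 0 < q) (h1 : q < 1) : 2 * thA (q ^ 2) ^ 2 = thA q ^ 2 + thB q ^ 2 := by
  rw [A_sq h0 h1, B_sq h0 h1]; ring
lemma qP_sq (h0 : 0 < q) (h1 : q < 1) : 2 * q * Psi (q ^ 2) ^ 2 = thA q ^ 2 - thB q ^ 2 := by
  rw [A_sq h0 h1, B_sq h0 h1]; ring
lemma gam_sq (h0 : 0 < q) (h1 : q < 1) : thB (q ^ 4) ^ 2 = thA (q ^ 2) * thB (q ^ 2) := by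
  obtain ⟨k0, k1⟩ := sq_lt_one h0 h1
  rw [AB_eq k0 k1, sq_sq]
lemma qPsi4 (h0 : 0 < q) (h1 : q < 1) : q * Psi q ^ 4 = thA q ^ 4 - thB q ^ 4 := by
  have := Psi_sq h0 h1
  have e1 := two_b_sq h0 h1
  have e2 := qP_sq h0 h1
  calc q * Psi q ^ 4 = q * (Psi q ^ 2) ^ 2 := by ring
    _ = 2 * thA (q ^ 2) ^ 2 * (2 * q * Psi (q ^ 2) ^ 2) := by rw [this]; ring
    _ = _ := by rw [e1, e2]; ring
lemma Psi_gam (h0 : 0 < q) (h1 : q < 1) :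
    Psi q * thB (q ^ 4) = 2 * thA (q ^ 2) * hh (q ^ 2) := by
  obtain ⟨k0, k1⟩ := sq_lt_one h0 h1
  obtain ⟨l0, l1⟩ := q4_lt_one h0 h1
  have a := Psi_pos h0 h1
  have b := B_pos l0 l1
  have c := A_pos k0 k1
  have d := hh_pos k0 k1
  have e1 := Psi_sq h0 h1
  have e2 := gam_sq h0 h1
  have e3 := hh_sq k0 k1
  refine (sq_eq_sq₀ (by positivity) (by positivity)).1 ?_
  rw [mul_pow, e1, e2]
  linear_combination -2 * thA (q ^ 2) ^ 2 * e3

lemma jac_diff (h0 : 0 < q) (h1 : q < 1) :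
    A2 q * thB q - thA q * B2 q = thA q * thB q * (thA q ^ 4 - thB q ^ 4) / 4 := by
  obtain ⟨k0, k1⟩ := sq_lt_one h0 h1
  rw [A2B h0 h1, jacobi k0 k1]
  have e1 := two_b_sq h0 h1
  have e2 := qP_sq h0 h1
  have e3 := AB_eq h0 h1
  calc _ = (2 * q * Psi (q ^ 2) ^ 2) * (2 * thA (q ^ 2) ^ 2) * (thB (q ^ 2) ^ 2) / 4 := by ring
    _ = _ := by rw [e1, e2, ← e3]; ring

lemma near {q : ℝ} (h0 : 0 < q) (h1 : q < 1) : ∀ᶠ y in 𝓝 q, 0 < y ∧ y < 1 :=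
  (lt_mem_nhds h0).and (gt_mem_nhds h1)

lemma deriv_of {f g : ℝ → ℝ} {q d e : ℝ} (h0 : 0 < q) (h1 : q < 1)
    (h : ∀ y, 0 < y → y < 1 → f y = g y) (hf : HasDerivAt f d q) (hg : HasDerivAt g e q) : d = e :=
  hf.unique (hg.congr_of_eventuallyEq ((near h0 h1).mono fun y hy => h y hy.1 hy.2))

lemma st3_eq (h0 : 0 < q) (h1 : q < 1) :
    st3 q * (thA q ^ 4 - thB q ^ 4) = 4 * Psi q * thA q * thB q *
      ((thA q ^ 3 * A2 q - thB q ^ 3 * B2 q)) +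
      4 * Psi q * (A2 q * thB q + thA q * B2 q) * (thA q ^ 4 - thB q ^ 4) := by
  obtain ⟨d, hd⟩ := derivPsi h0 h1
  have hA := derivA h0 h1
  have hB := derivB h0 h1
  have e1 := deriv_of h0 h1 (fun y y0 y1 => jacobi y0 y1) (derivjj h0 h1) ((hd.mul hA).mul hB)
  have e2 := deriv_of h0 h1 (fun y y0 y1 => qPsi4 y0 y1) ((hasDerivAt_id q).mul (hd.pow 4))
    ((hA.pow 4).sub (hB.pow 4))
  have e3 := qPsi4 h0 h1
  have e4 := jacobi h0 h1
  simp only [Pi.mul_apply, Pi.pow_apply, id] at e1 e2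
  rw [e4] at e1
  norm_num at e2
  field_simp at e1 e2
  rw [← e3]
  have hp := Psi_pos h0 h1
  linear_combination (q * Psi q ^ 4) * e1 + Psi q * thA q * thB q * e2

lemma s3_eq (h0 : 0 < q) (h1 : q < 1) :
    s3 q = thB (q ^ 4) * ((thA q * A2 q - thB q * B2 q) / 2 + (thA q ^ 2 - thB q ^ 2) / 8 *
      ((A2 q / thA q + B2 q / thB q) / 2
        + (thA q * A2 q + thB q * B2 q) / (thA q ^ 2 + thB q ^ 2))) := by
  obtain ⟨k0, k1⟩ := sq_lt_one h0 h1
  obtain ⟨l0, l1⟩ := q4_lt_one h0 h1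
  have hA := derivA h0 h1
  have hB := derivB h0 h1
  obtain ⟨db, hb⟩ : ∃ d, HasDerivAt (fun y => thA (y ^ 2)) d q :=
    ⟨_, HasDerivAt.comp (h₂ := thA) (h := fun y => y ^ 2) q (derivA k0 k1) (hasDerivAt_pow 2 q)⟩
  obtain ⟨dβ, hβ⟩ : ∃ d, HasDerivAt (fun y => thB (y ^ 2)) d q :=
    ⟨_, HasDerivAt.comp (h₂ := thB) (h := fun y => y ^ 2) q (derivB k0 k1) (hasDerivAt_pow 2 q)⟩
  obtain ⟨dγ, hγ⟩ : ∃ d, HasDerivAt (fun y => thB (y ^ 4)) d q :=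
    ⟨_, HasDerivAt.comp (h₂ := thB) (h := fun y => y ^ 4) q (derivB l0 l1) (hasDerivAt_pow 4 q)⟩
  have e1 := deriv_of h0 h1 (fun y y0 y1 => s1_eq y0 y1) (derivs1 h0 h1)
    ((((hA.pow 2).sub (hB.pow 2)).div_const 4).mul hγ)
  have e2 := deriv_of h0 h1 (fun y y0 y1 => gam_sq y0 y1) (hγ.pow 2) (hb.mul hβ)
  have e3 := deriv_of h0 h1 (fun y y0 y1 => AB_eq y0 y1) (hA.mul hB) (hβ.pow 2)
  have e4 := deriv_of h0 h1 (fun y y0 y1 => two_b_sq y0 y1) ((hb.pow 2).const_mul 2)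
    ((hA.pow 2).add (hB.pow 2))
  have f2 := gam_sq h0 h1
  have f3 := AB_eq h0 h1
  have f4 := two_b_sq h0 h1
  have pA := A_pos h0 h1
  have pB := B_pos h0 h1
  have pb := A_pos k0 k1
  have pβ := B_pos k0 k1
  have pγ := B_pos l0 l1
  simp only [Pi.mul_apply, Pi.pow_apply, Pi.sub_apply, Pi.div_apply] at e1 e2 e3 e4
  norm_num at e1 e2 e3 e4
  generalize thA q = A at *
  generalize thB q = B at *
  generalize thA (q ^ 2) = b at *
  generalize thB (q ^ 2) = β at *
  generalize thB (q ^ 4) = γ at *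
  generalize A2 q = a2 at *
  generalize B2 q = b2 at *
  have hb' : q * db / b = (A * a2 + B * b2) / (A ^ 2 + B ^ 2) := by
    rw [← f4]; field_simp; field_simp at e4; linear_combination e4
  have hβ' : q * dβ / β = (a2 / A + b2 / B) / 2 := by
    have : q * dβ / β = (q * (2 * β * dβ)) / (2 * β ^ 2) := by field_simp
    rw [this, ← f3, ← e3]; field_simp
  have hγ' : q * dγ / γ = (q * dβ / β + q * db / b) / 2 := by
    have : q * dγ / γ = (q * (2 * γ * dγ)) / (2 * γ ^ 2) := by field_simp
    rw [this, f2, e2]; field_simp; ring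
  rw [← hb', ← hβ']
  have e1' : s3 q = q * (s3 q / q) := by field_simp
  rw [e1', e1]
  have : q * dγ = γ * ((q * dβ / β + q * db / b) / 2) := by rw [← hγ']; field_simp
  have h5 : q * ((2 * A * (a2 / q) - 2 * B * (b2 / q)) / 4 * γ + (A ^ 2 - B ^ 2) / 4 * dγ)
     = (2 * A * a2 - 2 * B * b2) / 4 * γ + (A ^ 2 - B ^ 2) / 4 * (q * dγ) := by
    field_simp
  rw [h5, this]
  ring

end

end Rep


namespace Rep
open Filter Topology

section
variable {p : ℝ}

/-- Tails of the alternating theta series. -/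
noncomputable def GG (p : ℝ) (a : ℤ) : ℝ := ∑' j : ℤ, if a ≤ j then sg j * p ^ (j ^ 2 + j) else 0

lemma GG_summable (h0 : 0 < p) (h1 : p < 1) (P : ℤ → Prop) [DecidablePred P] :
    Summable fun j : ℤ => if P j then sg j * p ^ (j ^ 2 + j) else 0 :=
  ((decPsi' h0 h1).mono 1 zero_le_one fun n => by
    split_ifs
    · rw [one_mul]
    · rw [abs_zero]; positivity : Dec fun j : ℤ => if P j then sg j * p ^ (j ^ 2 + j) else 0).summable

lemma GG_compl (h0 : 0 < p) (h1 : p < 1) (a : ℤ) :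
    ∑' j : ℤ, (if j < a then sg j * p ^ (j ^ 2 + j) else 0) = - GG p a := by
  have := (GG_summable h0 h1 (fun j => a ≤ j)).tsum_add (GG_summable h0 h1 (fun j => j < a))
  rw [← GG] at this
  have h2 : ∑' j : ℤ, ((if a ≤ j then sg j * p ^ (j ^ 2 + j) else 0)
      + (if j < a then sg j * p ^ (j ^ 2 + j) else 0)) = 0 := by
    refine Eq.trans (tsum_congr fun j => ?_) (sum_psi_alt (q := p))
    by_cases h : a ≤ j
    · simp [h, not_lt.2 h]
    · simp [h, not_le.1 h]
  linarith

lemma GG_even (h0 : 0 < p) (h1 : p < 1) (a : ℤ) : GG p (-a) = GG p a := by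
  have h := GG_compl h0 h1 a
  rw [← tsum_refl (-1)] at h
  have : GG p (-a) = - ∑' j : ℤ, (if -1 - j < a then sg (-1 - j) * p ^ ((-1 - j) ^ 2 + (-1 - j)) else 0) := by
    rw [GG, ← tsum_neg]
    refine tsum_congr fun j => ?_
    rw [sg_sub, sg_neg, sg_one, show (-1 - j) ^ 2 + (-1 - j) = j ^ 2 + j by ring]
    by_cases h : -a ≤ j
    · rw [if_pos h, if_pos (by omega)]; ring
    · rw [if_neg h, if_neg (by omega)]; ring
  rw [this, h, neg_neg]

lemma GG_rec (h0 : 0 < p) (h1 : p < 1) (a : ℤ) :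
    GG p a - GG p (a + 1) = sg a * p ^ (a ^ 2 + a) := by
  rw [GG, GG, ← (GG_summable h0 h1 _).tsum_sub (GG_summable h0 h1 _), tsum_eq_single a]
  · simp
  · intro j hj
    by_cases h : a ≤ j
    · rw [if_pos h, if_pos (by omega), sub_self]
    · rw [if_neg h, if_neg (by omega), sub_self]

lemma GG_dec (h0 : 0 < p) (h1 : p < 1) : Dec (GG p) := by
  have key : ∀ a : ℤ, 0 ≤ a → |GG p a| ≤ thA p * p ^ a := by
    intro a ha
    rw [GG]
    have hb : Summable fun j : ℤ => p ^ (j ^ 2) * p ^ a := (decA h0 h1).summable.mul_right _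
    have := tsum_of_norm_bounded (f := fun j : ℤ => if a ≤ j then sg j * p ^ (j ^ 2 + j) else 0)
      hb.hasSum (fun j => by
        rw [Real.norm_eq_abs]
        split_ifs with h
        · rw [abs_mul, abs_sg, one_mul, abs_of_pos (by positivity), ← zpow_add₀ h0.ne']
          exact zpow_le_zpow_right_of_le_one₀ h0 h1.le (by omega)
        · rw [abs_zero]; positivity)
    rwa [tsum_mul_right] at this
  refine dec_geom h0 h1 (C := thA p) fun a => ?_
  rcases le_total 0 a with h | h
  · rw [abs_of_nonneg h]; exact key a h
  · rw [abs_of_nonpos h, ← GG_even h0 h1]; exact key (-a) (by omega)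

lemma GG_sum (h0 : 0 < p) (h1 : p < 1) : 2 * ∑' a, GG p a = jj p := by
  have d := GG_dec h0 h1
  have s1 := (d.mul_lin 2 1).summable
  have s2 := (d.mul_lin 2 (-1)).summable
  have e : ∑' a : ℤ, (2 * (a : ℝ) + -1) * GG p a = ∑' a : ℤ, (2 * (a : ℝ) + 1) * GG p (a + 1) := by
    rw [← tsum_shift 1]
    refine tsum_congr fun a => ?_
    push_cast; ring
  have s2' : Summable fun a : ℤ => (2 * (a : ℝ) + 1) * GG p (a + 1) := by
    refine ((Equiv.addRight (1 : ℤ)).summable_iff.2 s2).congr fun a => ?_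
    simp only [Function.comp, Equiv.coe_addRight]
    push_cast; ring
  have e1 : jj p = ∑' a : ℤ, (2 * (a : ℝ) + 1) * GG p a - ∑' a : ℤ, (2 * (a : ℝ) + 1) * GG p (a + 1) := by
    rw [← s1.tsum_sub s2', jj]
    refine tsum_congr fun a => ?_
    rw [← mul_sub, GG_rec h0 h1]; ring
  rw [e1, ← e, ← s1.tsum_sub s2, ← tsum_mul_left]
  refine tsum_congr fun a => ?_
  ring
end

section
variable {q : ℝ}

lemma zpow_le_one_aux (h0 : 0 < q) (h1 : q < 1) {d : ℤ} (hd : 0 ≤ d) : q ^ d ≤ 1 := by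
  have := zpow_le_zpow_right_of_le_one₀ h0 h1.le hd
  rwa [zpow_zero] at this

noncomputable def lam (q : ℝ) (d : ℤ) : ℝ := (q ^ d - q ^ (3 * d)) / (1 + q ^ (4 * d))

lemma lam_odd (h0 : 0 < q) (d : ℤ) : lam q (-d) = - lam q d := by
  have e3 : q ^ (3 * d) = (q ^ d) ^ 3 := by rw [mul_comm, zpow_mul]; norm_cast
  have e4 : q ^ (4 * d) = (q ^ d) ^ 4 := by rw [mul_comm, zpow_mul]; norm_cast
  have f3 : q ^ (3 * -d) = ((q ^ d) ^ 3)⁻¹ := by rw [mul_neg, zpow_neg, e3]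
  have f4 : q ^ (4 * -d) = ((q ^ d) ^ 4)⁻¹ := by rw [mul_neg, zpow_neg, e4]
  rw [lam, lam, e3, e4, f3, f4, zpow_neg]
  have : 0 < q ^ d := by positivity
  generalize q ^ d = x at *
  field_simp
  ring

lemma lam_bound_nonneg (h0 : 0 < q) (h1 : q < 1) (d : ℤ) (hd : 0 ≤ d) : |lam q d| ≤ q ^ d := by
  have a : q ^ (3 * d) ≤ q ^ d := zpow_le_zpow_right_of_le_one₀ h0 h1.le (by omega)
  have b : 0 < q ^ (3 * d) := by positivity
  have c : 0 < q ^ (4 * d) := by positivity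
  have e : 0 < q ^ d := by positivity
  rw [lam, abs_of_nonneg (div_nonneg (by linarith) (by linarith)), div_le_iff₀ (by linarith)]
  nlinarith

lemma lam_bound (h0 : 0 < q) (h1 : q < 1) (d : ℤ) : |lam q d| ≤ q ^ |d| := by
  rcases le_total 0 d with h | h
  · rw [abs_of_nonneg h]; exact lam_bound_nonneg h0 h1 d h
  · rw [abs_of_nonpos h, ← abs_neg, ← lam_odd h0]; exact lam_bound_nonneg h0 h1 (-d) (by omega)

lemma lam_le_one (h0 : 0 < q) (h1 : q < 1) (d : ℤ) : |lam q d| ≤ 1 :=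
  (lam_bound h0 h1 d).trans (zpow_le_one_aux h0 h1 (abs_nonneg d))

lemma lam_dec (h0 : 0 < q) (h1 : q < 1) : Dec (lam q) :=
  dec_geom h0 h1 (C := 1) fun d => by rw [one_mul]; exact lam_bound h0 h1 d

noncomputable def II (q : ℝ) (K : ℤ) : ℝ := ∑' d : ℤ, sg d * lam q d * q ^ (d ^ 2 - 2 * K * d)

lemma II_dec (h0 : 0 < q) (h1 : q < 1) (K : ℤ) :
    Dec fun d : ℤ => sg d * lam q d * q ^ (d ^ 2 - 2 * K * d) :=
  dec_quad h0 h1 (C := 1) 1 (-2 * K) 0 le_rfl fun d => by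
    rw [abs_mul, abs_mul, abs_sg, one_mul, abs_of_pos (show 0 < q ^ (d ^ 2 - 2 * K * d) by positivity),
      show 1 * d ^ 2 + -2 * K * d + 0 = d ^ 2 - 2 * K * d by ring]
    exact mul_le_mul_of_nonneg_right (lam_le_one h0 h1 d) (by positivity)

lemma alt_zero (k : ℤ) : ∑' d : ℤ, sg d * q ^ (d ^ 2 - (2 * k + 1) * d) = 0 := by
  apply tsum_refl_zero (2 * k + 1)
  intro n
  rw [sg_sub, sg_add, sg_two_mul, sg_one,
    show (2 * k + 1 - n) ^ 2 - (2 * k + 1) * (2 * k + 1 - n) = n ^ 2 - (2 * k + 1) * n by ring]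
  ring

lemma II_rec (h0 : 0 < q) (h1 : q < 1) (K : ℤ) : II q K + II q (K + 2) = 0 := by
  rw [II, II, ← (II_dec h0 h1 K).summable.tsum_add (II_dec h0 h1 (K + 2)).summable]
  have d1 : Summable fun d : ℤ => sg d * q ^ (d ^ 2 - (2 * (K + 1) + 1) * d) :=
    (dec_sq h0 h1 1 (-(2 * (K + 1) + 1)) 0 le_rfl).summable.congr fun d => by congr 2; ring
  have d2 : Summable fun d : ℤ => sg d * q ^ (d ^ 2 - (2 * K + 1) * d) :=
    (dec_sq h0 h1 1 (-(2 * K + 1)) 0 le_rfl).summable.congr fun d => by congr 2; ring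
  have : ∀ d : ℤ, sg d * lam q d * q ^ (d ^ 2 - 2 * K * d)
      + sg d * lam q d * q ^ (d ^ 2 - 2 * (K + 2) * d)
      = sg d * q ^ (d ^ 2 - (2 * (K + 1) + 1) * d) - sg d * q ^ (d ^ 2 - (2 * K + 1) * d) := by
    intro d
    rw [lam]
    have hp : 0 < q ^ (4 * d) := by positivity
    rw [show d ^ 2 - 2 * K * d = (d ^ 2 - 2 * (K + 2) * d) + 4 * d by ring,
      show d ^ 2 - (2 * (K + 1) + 1) * d = (d ^ 2 - 2 * (K + 2) * d) + d by ring,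
      show d ^ 2 - (2 * K + 1) * d = (d ^ 2 - 2 * (K + 2) * d) + 3 * d by ring,
      zpow_add₀ h0.ne' _ (4 * d), zpow_add₀ h0.ne' _ d, zpow_add₀ h0.ne' _ (3 * d)]
    field_simp
    ring
  simp_rw [this]
  rw [d1.tsum_sub d2, alt_zero, alt_zero, sub_zero]

lemma II_odd (h0 : 0 < q) (K : ℤ) : II q (-K) = - II q K := by
  rw [II, II, ← tsum_refl 0, ← tsum_neg]
  refine tsum_congr fun d => ?_
  rw [zero_sub, sg_neg, lam_odd h0, show (-d) ^ 2 - 2 * -K * -d = d ^ 2 - 2 * K * d by ring]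
  ring

lemma II_two_mul (h0 : 0 < q) (h1 : q < 1) (m : ℤ) :
    II q (2 * m) = 0 ∧ II q (2 * m + 1) = sg m * II q 1 := by
  induction m using Int.induction_on with
  | zero =>
    have := II_odd h0 0
    rw [neg_zero] at this
    simp [sg_zero]; linarith
  | succ n ih =>
    have a := II_rec h0 h1 (2 * n)
    have b := II_rec h0 h1 (2 * n + 1)
    rw [show (2 : ℤ) * (n + 1) = 2 * n + 2 by ring, show (2 : ℤ) * n + 2 + 1 = 2 * n + 1 + 2 by ring,
      sg_add, sg_one]
    constructor <;> linarith [ih.1, ih.2]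
  | pred n ih =>
    have a := II_rec h0 h1 (2 * (-n - 1))
    have b := II_rec h0 h1 (2 * (-n - 1) + 1)
    rw [show (2 : ℤ) * (-n - 1) + 2 = 2 * -n by ring] at a
    rw [show (2 : ℤ) * (-n - 1) + 1 + 2 = 2 * -n + 1 by ring] at b
    have c : sg (-(n : ℤ) - 1) = - sg (-n) := by rw [sg_sub, sg_one]; ring
    rw [c]
    constructor <;> linarith [ih.1, ih.2]

noncomputable def WW (q : ℝ) (K : ℤ) : ℝ := ∑' n : ℤ, lam q (K - n) * (sg n * q ^ (n ^ 2))

lemma WW_def (K : ℤ) : WW q K = ∑' n : ℤ, lam q (K - n) * (sg n * q ^ (n ^ 2)) := rfl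

lemma WW_eq (h0 : 0 < q) (K : ℤ) : WW q K = sg K * q ^ (K ^ 2) * II q K := by
  rw [WW, II, ← tsum_mul_left, ← tsum_refl K]
  refine tsum_congr fun d => ?_
  rw [sub_sub_cancel, sg_sub, show (K - d) ^ 2 = K ^ 2 + (d ^ 2 - 2 * K * d) by ring,
    zpow_add₀ h0.ne']
  ring

lemma WW_even (h0 : 0 < q) (h1 : q < 1) (m : ℤ) : WW q (2 * m) = 0 := by
  rw [WW_eq h0, (II_two_mul h0 h1 m).1, mul_zero]

lemma WW_odd (h0 : 0 < q) (h1 : q < 1) (m : ℤ) :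
    WW q (2 * m + 1) = (-II q 1) * (sg m * q ^ ((2 * m + 1) ^ 2)) := by
  rw [WW_eq h0, (II_two_mul h0 h1 m).2, sg_add, sg_two_mul, sg_one]
  ring

lemma WW_bound (h0 : 0 < q) (h1 : q < 1) (K : ℤ) : |WW q K| ≤ |II q 1| * q ^ (K ^ 2) := by
  rcases Int.even_or_odd' K with ⟨m, rfl | rfl⟩
  · rw [WW_even h0 h1, abs_zero]; positivity
  · rw [WW_odd h0 h1, abs_mul, abs_mul, abs_sg, abs_neg, one_mul,
      abs_of_pos (show 0 < q ^ ((2 * m + 1) ^ 2) by positivity)]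

lemma WW_dec (h0 : 0 < q) (h1 : q < 1) : Dec (WW q) :=
  dec_quad h0 h1 (C := |II q 1|) 1 0 0 le_rfl fun K => by
    have := WW_bound h0 h1 K
    simpa using this

lemma sum_odd_zero {f : ℤ → ℝ} (h : ∀ n, f (-n) = - f n) : ∑' n, f n = 0 :=
  tsum_refl_zero 0 fun n => by rw [zero_sub, h]

noncomputable def M1 (q : ℝ) : ℝ := ∑' d : ℤ, (d : ℝ) * lam q d
noncomputable def M3 (q : ℝ) : ℝ := ∑' d : ℤ, (d : ℝ) ^ 3 * lam q d

lemma W_mom1 (h0 : 0 < q) (h1 : q < 1) : M1 q * thB q = (-II q 1) * s1 q := by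
  have l := lam_dec h0 h1
  have b := decB h0 h1
  have H := mom1 (u := fun n => (n : ℝ)) (v := fun n => (n : ℝ)) l l.mul_id b b.mul_id
  have z0 : ∑' n, lam q n = 0 := sum_odd_zero (lam_odd h0)
  rw [z0, zero_mul, add_zero] at H
  have hs : Summable fun p : ℤ × ℤ => ((p.1 + p.2 : ℤ) : ℝ) * (lam q p.1 * (sg p.2 * q ^ (p.2 ^ 2))) :=
    H.summable.congr fun p => by push_cast; ring
  have C := conv_sum (h := fun n => (n : ℝ)) (s := fun n => n) (f := lam q)
    (g := fun n => sg n * q ^ (n ^ 2)) hs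
  have e : ∑' p : ℤ × ℤ, ((p.1 + p.2 : ℤ) : ℝ) * (lam q p.1 * (sg p.2 * q ^ (p.2 ^ 2)))
      = M1 q * thB q := by
    rw [M1, thB, ← H.tsum_eq]
    exact tsum_congr fun p => by push_cast; ring
  rw [e] at C
  rw [← C]
  simp_rw [← WW_def]
  rw [tsum_even_odd (WW_dec h0 h1).mul_id.summable, s1, ← tsum_mul_left]
  simp_rw [WW_even h0 h1, WW_odd h0 h1, mul_zero, tsum_zero, zero_add]
  exact tsum_congr fun p => by push_cast; ring

lemma W_mom3 (h0 : 0 < q) (h1 : q < 1) :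
    M3 q * thB q + 3 * M1 q * B2 q = (-II q 1) * s3 q := by
  have l := lam_dec h0 h1
  have b := decB h0 h1
  have H := mom3 (u := fun n => (n : ℝ)) (v := fun n => (n : ℝ)) l l.mul_id l.sq l.cube
    b b.mul_id b.sq b.cube
  have z0 : ∑' n, lam q n = 0 := sum_odd_zero (lam_odd h0)
  have z2 : ∑' n : ℤ, (n : ℝ) ^ 2 * lam q n = 0 := sum_odd_zero fun n => by
    rw [lam_odd h0]; push_cast; ring
  rw [z0, z2, zero_mul, zero_mul, add_zero, mul_zero, add_zero] at H
  have hs : Summable fun p : ℤ × ℤ =>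
      ((p.1 + p.2 : ℤ) : ℝ) ^ 3 * (lam q p.1 * (sg p.2 * q ^ (p.2 ^ 2))) :=
    H.summable.congr fun p => by push_cast; ring
  have C := conv_sum (h := fun n => (n : ℝ) ^ 3) (s := fun n => n) (f := lam q)
    (g := fun n => sg n * q ^ (n ^ 2)) hs
  have e : ∑' p : ℤ × ℤ, ((p.1 + p.2 : ℤ) : ℝ) ^ 3 * (lam q p.1 * (sg p.2 * q ^ (p.2 ^ 2)))
      = M3 q * thB q + 3 * M1 q * B2 q := by
    rw [M1, M3, thB, B2, mul_assoc, ← H.tsum_eq]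
    exact tsum_congr fun p => by push_cast; ring
  rw [e] at C
  rw [← C]
  simp_rw [← WW_def]
  rw [tsum_even_odd (WW_dec h0 h1).cube.summable, s3, ← tsum_mul_left]
  simp_rw [WW_even h0 h1, WW_odd h0 h1, mul_zero, tsum_zero, zero_add]
  exact tsum_congr fun p => by push_cast; ring

noncomputable def rho (q : ℝ) (d : ℤ) : ℝ := q ^ (-d) * (lam q d - if 1 ≤ d then q ^ d else 0)

lemma rho_dec (h0 : 0 < q) (h1 : q < 1) : Dec (rho q) := by
  refine dec_geom h0 h1 (C := 2) fun d => ?_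
  by_cases h : 1 ≤ d
  · rw [rho, if_pos h, abs_of_pos (show 0 < d by omega)]
    have hx : 0 < q ^ d := by positivity
    have hx1 : q ^ d ≤ 1 := zpow_le_one_aux h0 h1 (by omega)
    have e : q ^ (-d) * (lam q d - q ^ d)
        = - ((q ^ d) ^ 2 * (1 + (q ^ d) ^ 2) / (1 + (q ^ d) ^ 4)) := by
      have e3 : q ^ (3 * d) = (q ^ d) ^ 3 := by rw [mul_comm, zpow_mul]; norm_cast
      have e4 : q ^ (4 * d) = (q ^ d) ^ 4 := by rw [mul_comm, zpow_mul]; norm_cast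
      rw [lam, e3, e4, zpow_neg]
      generalize q ^ d = x at *
      field_simp
      ring
    rw [e, abs_neg]
    generalize q ^ d = x at *
    rw [abs_of_nonneg (by positivity), div_le_iff₀ (by positivity)]
    have : x ^ 2 ≤ x := by nlinarith
    have : 0 < x ^ 4 := by positivity
    nlinarith
  · rw [rho, if_neg h, sub_zero, abs_mul, abs_of_pos (show 0 < q ^ (-d) by positivity)]
    have a := lam_bound h0 h1 d
    have b : q ^ (-d) ≤ 1 := zpow_le_one_aux h0 h1 (by omega)
    have c : 0 < q ^ (-d) := by positivity
    have e : 0 < q ^ |d| := by positivity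
    nlinarith [abs_nonneg (lam q d)]

lemma W_term (h0 : 0 < q) (h1 : q < 1) (K : ℤ) :
    q ^ (-K) * WW q K - GG q (K - 1) = ∑' n, rho q (K - n) * (sg n * q ^ (n ^ 2 - n)) := by
  have s1 : Summable fun n : ℤ => lam q (K - n) * (sg n * q ^ (n ^ 2)) := by
    refine ((decB h0 h1).mono 1 zero_le_one fun n => ?_).summable
    rw [abs_mul]
    exact mul_le_mul_of_nonneg_right (lam_le_one h0 h1 _) (abs_nonneg _)
  have g := GG_compl h0 h1 (K - 1)
  rw [← tsum_shift (-1)] at g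
  have s2 : Summable fun n : ℤ =>
      if n + -1 < K - 1 then sg (n + -1) * q ^ ((n + -1) ^ 2 + (n + -1)) else 0 := by
    have := (Equiv.addRight (-1 : ℤ)).summable_iff.2 (GG_summable h0 h1 (fun n => n < K - 1))
    simpa only [Function.comp_def, Equiv.coe_addRight] using this
  rw [WW, sub_eq_add_neg (q ^ (-K) * _), ← g, ← tsum_mul_left, ← (s1.mul_left _).tsum_add s2]
  refine tsum_congr fun n => ?_
  rw [rho]
  have e1 : q ^ (n ^ 2 - n) = q ^ (n ^ 2) * q ^ (-n) := by rw [← zpow_add₀ h0.ne']; congr 1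
  have e2 : q ^ (-(K - n)) * q ^ (-n) = q ^ (-K) := by rw [← zpow_add₀ h0.ne']; congr 1; ring
  have e3 : q ^ (-(K - n)) * q ^ (K - n) = 1 := by rw [← zpow_add₀ h0.ne']; simp
  have e4 : (n + -1) ^ 2 + (n + -1) = n ^ 2 - n := by ring
  have e5 : sg (n + -1) = - sg n := by rw [sg_add, sg_neg, sg_one]; ring
  rw [e4, e5]
  by_cases h : 1 ≤ K - n
  · rw [if_pos h, if_pos (by omega), mul_sub, e3, sub_mul, one_mul, e1, ← e2]
    ring
  · rw [if_neg h, if_neg (by omega), e1, ← e2]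
    ring

lemma W_const (h0 : 0 < q) (h1 : q < 1) : 2 * ((-II q 1) * hh (q ^ 2)) = jj q := by
  have dW : Dec fun K : ℤ => q ^ (-K) * WW q K :=
    dec_quad h0 h1 (C := |II q 1|) 1 (-1) 0 le_rfl fun K => by
      rw [abs_mul, abs_of_pos (show 0 < q ^ (-K) by positivity),
        show 1 * K ^ 2 + -1 * K + 0 = -K + K ^ 2 by ring, zpow_add₀ h0.ne']
      have := mul_le_mul_of_nonneg_left (WW_bound h0 h1 K) (show 0 ≤ q ^ (-K) by positivity)
      linarith
  have sG : Summable fun K : ℤ => GG q (K - 1) :=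
    (Equiv.subRight (1 : ℤ)).summable_iff.2 (GG_dec h0 h1).summable
  have dg : Dec fun n : ℤ => sg n * q ^ (n ^ 2 - n) :=
    (dec_sq h0 h1 1 (-1) 0 le_rfl).congr fun n => by congr 2; ring
  have S := (rho_dec h0 h1).mul_summable dg
  have C := conv_sum (f := rho q) (g := fun n : ℤ => sg n * q ^ (n ^ 2 - n))
    (h := fun _ => 1) (s := id) (S.congr fun p => by ring)
  simp only [id, one_mul] at C
  simp_rw [← W_term h0 h1] at C
  rw [← (rho_dec h0 h1).tsum_mul dg] at C
  have z := alt_zero (q := q) 0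
  simp only [mul_zero, zero_add, one_mul] at z
  rw [z, mul_zero, dW.summable.tsum_sub sG] at C
  have e1 : ∑' K : ℤ, GG q (K - 1) = ∑' K, GG q K := (Equiv.subRight (1 : ℤ)).tsum_eq _
  have e2 : ∑' K : ℤ, q ^ (-K) * WW q K = (-II q 1) * hh (q ^ 2) := by
    rw [tsum_even_odd dW.summable, hh, ← tsum_mul_left]
    simp_rw [WW_even h0 h1, WW_odd h0 h1, mul_zero, tsum_zero, zero_add]
    refine tsum_congr fun m => ?_
    rw [sqz, show 2 * (2 * m ^ 2 + m) = -(2 * m + 1) + (2 * m + 1) ^ 2 by ring, zpow_add₀ h0.ne']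
    ring
  rw [e1, e2] at C
  rw [← GG_sum h0 h1]
  linarith

lemma c_eq (h0 : 0 < q) (h1 : q < 1) :
    (-II q 1) * thB (q ^ 4) = thA (q ^ 2) * thA q * thB q := by
  obtain ⟨k0, k1⟩ := sq_lt_one h0 h1
  have a := W_const h0 h1
  have b := Psi_gam h0 h1
  have c := hh_pos k0 k1
  rw [jacobi h0 h1] at a
  have : hh (q ^ 2) * ((-II q 1) * thB (q ^ 4)) = hh (q ^ 2) * (thA (q ^ 2) * thA q * thB q) := by
    linear_combination thB (q ^ 4) / 2 * a + thA q * thB q / 2 * b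
  exact mul_left_cancel₀ c.ne' this

lemma M1_eq (h0 : 0 < q) (h1 : q < 1) :
    M1 q = thA (q ^ 2) * thA q * (thA q ^ 2 - thB q ^ 2) / 4 := by
  have a := W_mom1 h0 h1
  rw [s1_eq h0 h1] at a
  have b := c_eq h0 h1
  have c := B_pos h0 h1
  apply mul_right_cancel₀ c.ne'
  rw [a]
  linear_combination (thA q ^ 2 - thB q ^ 2) / 4 * b

lemma M3_eq (h0 : 0 < q) (h1 : q < 1) :
    M3 q = thA (q ^ 2) * thA q * (thA q ^ 2 - thB q ^ 2) *
      (11 * thA q ^ 4 + 6 * thA q ^ 2 * thB q ^ 2 - thB q ^ 4) / 64 := by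
  have a := W_mom3 h0 h1
  rw [s3_eq h0 h1, M1_eq h0 h1, ← mul_assoc, c_eq h0 h1] at a
  have b := jac_diff h0 h1
  have pA := A_pos h0 h1
  have pB := B_pos h0 h1
  have hx : A2 q = (B2 q / thB q + (thA q ^ 4 - thB q ^ 4) / 4) * thA q := by
    field_simp; linear_combination 4 * b
  rw [hx] at a
  apply mul_right_cancel₀ pB.ne'
  rw [← eq_sub_iff_add_eq] at a
  rw [a]
  have hAB : thA q ^ 2 + thB q ^ 2 ≠ 0 := by positivity
  generalize thA q = A at *
  generalize thB q = B at *
  field_simp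
  ring

end
end Rep


namespace Rep
open Filter Topology

section
variable {q : ℝ}

/-- `X8 e = χ₈(2e+1)`. -/
noncomputable def X8 (e : ℤ) : ℝ := if e % 4 = 0 ∨ e % 4 = 3 then 1 else -1

lemma X8_two (e : ℤ) : X8 (e + 2) = - X8 e := by
  by_cases h : e % 4 = 0 ∨ e % 4 = 3
  · rw [X8, X8, if_pos h, if_neg (by omega)]
  · rw [X8, X8, if_neg h, if_pos (by omega), neg_neg]

lemma X8_refl (e : ℤ) : X8 (-1 - e) = X8 e := by
  by_cases h : e % 4 = 0 ∨ e % 4 = 3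
  · rw [X8, X8, if_pos h, if_pos (by omega)]
  · rw [X8, X8, if_neg h, if_neg (by omega)]

lemma abs_X8 (e : ℤ) : |X8 e| = 1 := by
  rw [X8]; split_ifs <;> simp

lemma X8_add (e m : ℤ) : X8 (e + 2 * m) = sg m * X8 e := by
  induction m using Int.induction_on with
  | zero => simp [sg_zero]
  | succ n ih =>
    rw [show e + 2 * ((n : ℤ) + 1) = (e + 2 * n) + 2 by ring, X8_two, ih, sg_add, sg_one]; ring
  | pred n ih =>
    have := X8_two (e + 2 * (-(n : ℤ) - 1))
    rw [show e + 2 * (-(n : ℤ) - 1) + 2 = e + 2 * -n by ring, ih] at this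
    rw [sg_sub, sg_one]; linarith

lemma X8_zero : X8 0 = 1 := by simp [X8]
lemma X8_neg_one : X8 (-1) = 1 := by rw [X8, if_pos (by norm_num)]
lemma X8_one : X8 1 = -1 := by rw [X8, if_neg (by norm_num)]

noncomputable def muu (q : ℝ) (e : ℤ) : ℝ := q ^ (2 * (2 * e + 1)) / (1 - q ^ (2 * (2 * e + 1)))

lemma qodd_ne (h0 : 0 < q) (h1 : q < 1) (e : ℤ) : 1 - q ^ (2 * (2 * e + 1)) ≠ 0 := by
  intro h
  have : q ^ (2 * (2 * e + 1)) = 1 := by linarith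
  rw [zpow_eq_one_iff_right₀ h0.le h1.ne] at this
  omega

lemma muu_refl (h0 : 0 < q) (h1 : q < 1) (e : ℤ) : muu q (-1 - e) = -1 - muu q e := by
  have h := qodd_ne h0 h1 e
  have h' := qodd_ne h0 h1 (-1 - e)
  have e1 : q ^ (2 * (2 * (-1 - e) + 1)) = (q ^ (2 * (2 * e + 1)))⁻¹ := by
    rw [← zpow_neg]; congr 1; ring
  rw [muu, muu]
  rw [e1] at h' ⊢
  have hp : 0 < q ^ (2 * (2 * e + 1)) := by positivity
  generalize q ^ (2 * (2 * e + 1)) = x at *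
  have h2 : x - 1 ≠ 0 := fun k => h (by linarith)
  field_simp
  ring

noncomputable def ell (q : ℝ) (e : ℤ) : ℝ := X8 e * (muu q e + if e < 0 then 1 else 0)

lemma ell_refl (h0 : 0 < q) (h1 : q < 1) (e : ℤ) : ell q (-1 - e) = - ell q e := by
  rw [ell, ell, X8_refl, muu_refl h0 h1]
  by_cases h : e < 0
  · rw [if_pos h, if_neg (by omega)]; ring
  · rw [if_neg h, if_pos (by omega)]; ring

lemma ell_bound_nonneg (h0 : 0 < q) (h1 : q < 1) (e : ℤ) (he : 0 ≤ e) :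
    |ell q e| ≤ 1 / (1 - q) * q ^ e := by
  rw [ell, if_neg (by omega), add_zero, abs_mul, abs_X8, one_mul, muu]
  have a : q ^ (2 * (2 * e + 1)) ≤ q ^ e := zpow_le_zpow_right_of_le_one₀ h0 h1.le (by omega)
  have b : q ^ (2 * (2 * e + 1)) ≤ q ^ (1 : ℤ) := zpow_le_zpow_right_of_le_one₀ h0 h1.le (by omega)
  rw [zpow_one] at b
  have c : 0 < q ^ (2 * (2 * e + 1)) := by positivity
  have h2 : 0 < 1 - q := by linarith
  rw [abs_of_nonneg (div_nonneg c.le (by linarith)), div_le_iff₀ (by linarith)]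
  have h3 : 1 ≤ 1 / (1 - q) * (1 - q ^ (2 * (2 * e + 1))) := by
    rw [div_mul_eq_mul_div, one_mul, le_div_iff₀ h2]; linarith
  have h4 : 0 < q ^ e := by positivity
  nlinarith

lemma ell_dec (h0 : 0 < q) (h1 : q < 1) : Dec (ell q) := by
  refine dec_geom h0 h1 (C := 1 / (1 - q) * q⁻¹) fun e => ?_
  have h2 : 0 < 1 - q := by linarith
  rcases le_or_gt 0 e with h | h
  · refine (ell_bound_nonneg h0 h1 e h).trans ?_
    rw [abs_of_nonneg h]
    have : 1 ≤ q⁻¹ := (one_le_inv₀ h0).2 h1.le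
    have h4 : 0 < q ^ e := by positivity
    have : 1 / (1 - q) * 1 ≤ 1 / (1 - q) * q⁻¹ := by gcongr
    nlinarith
  · have := ell_bound_nonneg h0 h1 (-1 - e) (by omega)
    rw [ell_refl h0 h1, abs_neg] at this
    rw [abs_of_neg h]
    refine this.trans (le_of_eq ?_)
    rw [show -1 - e = -1 + -e by ring, zpow_add₀ h0.ne', zpow_neg_one]; ring

lemma muu_bound (h0 : 0 < q) (h1 : q < 1) : ∃ C, 0 ≤ C ∧ ∀ e, |X8 e * muu q e| ≤ C := by
  obtain ⟨r, C, r0, r1, h⟩ := ell_dec h0 h1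
  have hC : 0 ≤ C := by simpa using (abs_nonneg _).trans (h 0)
  refine ⟨C + 1, by linarith, fun e => ?_⟩
  have e1 : X8 e * muu q e = ell q e - X8 e * (if e < 0 then 1 else 0) := by rw [ell]; ring
  rw [e1]
  refine (abs_sub _ _).trans ?_
  have a : |ell q e| ≤ C := (h e).trans (mul_le_of_le_one_right hC (pow_le_one₀ r0.le r1.le))
  have b : |X8 e * (if e < 0 then 1 else 0)| ≤ 1 := by
    rw [abs_mul, abs_X8]; split_ifs <;> simp
  linarith

noncomputable def tt (q : ℝ) (j : ℤ) : ℝ := (q ^ 4) ^ (j ^ 2 + j)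

lemma tt_eq (j : ℤ) : tt q j = q ^ (4 * (j ^ 2 + j)) := by rw [tt, q4z]

lemma tt_refl (j : ℤ) : tt q (-1 - j) = tt q j := by
  rw [tt, tt]; congr 1; ring

lemma tt_dec (h0 : 0 < q) (h1 : q < 1) : Dec (tt q) := by
  obtain ⟨l0, l1⟩ := q4_lt_one h0 h1
  exact decPsi l0 l1

lemma tt_alt : ∑' j, sg j * tt q j = 0 := by
  unfold tt; exact sum_psi_alt

lemma Uterm_dec (h0 : 0 < q) (h1 : q < 1) (i : ℤ) :
    Dec fun j => X8 (i - (2 * j + 1)) * muu q (i - (2 * j + 1)) * tt q j := by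
  obtain ⟨C, hC, h⟩ := muu_bound h0 h1
  refine (tt_dec h0 h1).mono C hC fun n => ?_
  rw [abs_mul]
  exact mul_le_mul_of_nonneg_right (h _) (abs_nonneg _)

noncomputable def VV (q : ℝ) (i : ℤ) : ℝ :=
  ∑' j : ℤ, X8 (i - (2 * j + 1)) * muu q (i - (2 * j + 1)) * tt q j

lemma X8_sub (i j : ℤ) : X8 (i - (2 * j + 1)) = sg j * X8 (i - 1) := by
  rw [show i - (2 * j + 1) = (i - 1) + 2 * -j by ring, X8_add, sg_neg]

lemma X8_sum (i : ℤ) : ∑' j : ℤ, X8 (i - (2 * j + 1)) * tt q j = 0 := by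
  have : ∀ j : ℤ, X8 (i - (2 * j + 1)) * tt q j = X8 (i - 1) * (sg j * tt q j) := fun j => by
    rw [X8_sub]; ring
  simp_rw [this]
  rw [tsum_mul_left, tt_alt, mul_zero]

lemma X8_summable (h0 : 0 < q) (h1 : q < 1) (i : ℤ) :
    Summable fun j : ℤ => X8 (i - (2 * j + 1)) * tt q j :=
  ((tt_dec h0 h1).mono 1 zero_le_one fun n => by rw [abs_mul, abs_X8] : Dec _).summable

lemma VV_refl (h0 : 0 < q) (h1 : q < 1) (i : ℤ) : VV q (-1 - i) = - VV q i := by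
  have : VV q (-1 - i) = ∑' j : ℤ, (- (X8 (i - (2 * j + 1)) * muu q (i - (2 * j + 1)) * tt q j)
      - X8 (i - (2 * j + 1)) * tt q j) := by
    rw [VV, ← tsum_refl (-1)]
    refine tsum_congr fun j => ?_
    rw [show -1 - i - (2 * (-1 - j) + 1) = -1 - (i - (2 * j + 1)) by ring, X8_refl,
      muu_refl h0 h1, tt_refl]
    ring
  rw [this, (Uterm_dec h0 h1 i).summable.neg.tsum_sub (X8_summable h0 h1 i), X8_sum, tsum_neg, VV,
    sub_zero]

lemma VV_two (h0 : 0 < q) (h1 : q < 1) (i : ℤ) : VV q (i + 2) = q ^ (4 * i + 6) * VV q i := by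
  have a : ∀ j : ℤ, X8 (i + 2 - (2 * (j + 1) + 1)) * muu q (i + 2 - (2 * (j + 1) + 1)) * tt q (j + 1)
      = q ^ (4 * i + 6) * (X8 (i - (2 * j + 1)) * muu q (i - (2 * j + 1)) * tt q j
        + X8 (i - (2 * j + 1)) * tt q j) := by
    intro j
    rw [show i + 2 - (2 * (j + 1) + 1) = i - (2 * j + 1) by ring]
    have e1 : q ^ (4 * i + 6) * tt q j = tt q (j + 1) * q ^ (2 * (2 * (i - (2 * j + 1)) + 1)) := by
      rw [tt_eq, tt_eq, ← zpow_add₀ h0.ne', ← zpow_add₀ h0.ne']; congr 1; ring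
    have h := qodd_ne h0 h1 (i - (2 * j + 1))
    have e2 : muu q (i - (2 * j + 1)) = q ^ (2 * (2 * (i - (2 * j + 1)) + 1)) * (muu q (i - (2 * j + 1)) + 1) := by
      rw [muu]
      generalize q ^ (2 * (2 * (i - (2 * j + 1)) + 1)) = x at *
      field_simp
      ring
    linear_combination X8 (i - (2 * j + 1)) * tt q (j + 1) * e2
      - X8 (i - (2 * j + 1)) * (muu q (i - (2 * j + 1)) + 1) * e1
  rw [VV, ← tsum_shift 1]
  simp_rw [a]
  rw [tsum_mul_left, (Uterm_dec h0 h1 i).summable.tsum_add (X8_summable h0 h1 i), X8_sum, VV, add_zero]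

lemma VV_eq (h0 : 0 < q) (h1 : q < 1) (i : ℤ) : VV q i = VV q 0 * (sg i * q ^ (i ^ 2 + i)) := by
  have key : ∀ m : ℤ, VV q (2 * m) = VV q 0 * (q ^ ((2 * m) ^ 2 + 2 * m)) := by
    intro m
    induction m using Int.induction_on with
    | zero => simp
    | succ n ih =>
      rw [show (2 : ℤ) * (n + 1) = 2 * n + 2 by ring, VV_two h0 h1, ih,
        show ((2 : ℤ) * n + 2) ^ 2 + (2 * n + 2) = (4 * (2 * n) + 6) + ((2 * n) ^ 2 + 2 * n) by ring,
        zpow_add₀ h0.ne' (4 * (2 * (n : ℤ)) + 6)]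
      ring
    | pred n ih =>
      have a := VV_two h0 h1 (2 * (-(n : ℤ) - 1))
      rw [show (2 : ℤ) * (-n - 1) + 2 = 2 * -n by ring, ih,
        show ((2 : ℤ) * -n) ^ 2 + (2 * -n) = (4 * (2 * (-n - 1)) + 6) + ((2 * (-n - 1)) ^ 2 + 2 * (-n - 1)) by ring,
        zpow_add₀ h0.ne' (4 * (2 * (-(n : ℤ) - 1)) + 6)] at a
      have hp : 0 < q ^ (4 * (2 * (-(n : ℤ) - 1)) + 6) := by positivity
      apply mul_left_cancel₀ hp.ne'
      rw [← a]; ring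
  rcases Int.even_or_odd' i with ⟨m, rfl | rfl⟩
  · rw [key, sg_two_mul, one_mul]
  · have a := VV_refl h0 h1 (2 * (-1 - m))
    rw [show -1 - 2 * (-1 - m) = 2 * m + 1 by ring, key] at a
    rw [a, sg_add, sg_two_mul, sg_one,
      show (2 * (-1 - m)) ^ 2 + 2 * (-1 - m) = (2 * m + 1) ^ 2 + (2 * m + 1) by ring]
    ring

end
end Rep


namespace Rep
open Filter Topology

section
variable {q : ℝ}

lemma conv_summable {f g h : ℤ → ℝ} {s : ℤ → ℤ}
    (hs : Summable fun p : ℤ × ℤ => h (p.1 + s p.2) * (f p.1 * g p.2)) :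
    Summable fun K => h K * ∑' j, f (K - s j) * g j := by
  let e : ℤ × ℤ ≃ ℤ × ℤ :=
    { toFun := fun p => (p.1 - s p.2, p.2)
      invFun := fun p => (p.1 + s p.2, p.2)
      left_inv := fun p => by simp
      right_inv := fun p => by simp }
  have hs' := e.summable_iff.2 hs
  have : ∀ p : ℤ × ℤ, h ((e p).1 + s (e p).2) * (f (e p).1 * g (e p).2)
      = h p.1 * (f (p.1 - s p.2) * g p.2) := fun p => by simp [e]
  simp_rw [Function.comp_def, this] at hs'
  have := hs'.prod
  simpa only [tsum_mul_left] using this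

noncomputable def yy (q : ℝ) (a : ℤ) : ℝ := sg a * GG (q ^ 4) a

lemma yy_dec (h0 : 0 < q) (h1 : q < 1) : Dec (yy q) := by
  obtain ⟨l0, l1⟩ := q4_lt_one h0 h1
  exact (GG_dec l0 l1).mono 1 zero_le_one fun n => by rw [yy, abs_mul, abs_sg]

lemma yy_rec (h0 : 0 < q) (h1 : q < 1) (a : ℤ) : yy q a + yy q (a + 1) = tt q a := by
  obtain ⟨l0, l1⟩ := q4_lt_one h0 h1
  have := GG_rec l0 l1 a
  rw [← tt] at this
  rw [yy, yy, sg_add, sg_one]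
  linear_combination sg a * this + tt q a * sg_mul_self a

noncomputable def CV (q : ℝ) (i : ℤ) : ℝ := ∑' j : ℤ, ell q (i - (2 * j + 1)) * tt q j

lemma CV_def (i : ℤ) : CV q i = ∑' j : ℤ, ell q (i - (2 * j + 1)) * tt q j := rfl

lemma CV_sub (h0 : 0 < q) (h1 : q < 1) (i a : ℤ) (ha : ∀ j, i ≤ 2 * j ↔ a ≤ j) :
    CV q i = VV q i + X8 (i - 1) * GG (q ^ 4) a := by
  obtain ⟨l0, l1⟩ := q4_lt_one h0 h1
  rw [CV, VV, GG, ← tsum_mul_left,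
    ← (Uterm_dec h0 h1 i).summable.tsum_add ((GG_summable l0 l1 (fun j => a ≤ j)).mul_left _)]
  refine tsum_congr fun j => ?_
  rw [ell, ← tt]
  by_cases h : a ≤ j
  · have := (ha j).2 h
    rw [if_pos h, if_pos (by omega), mul_add, X8_sub]; ring
  · have : ¬ (i ≤ 2 * j) := fun k => h ((ha j).1 k)
    rw [if_neg h, if_neg (by omega), mul_add, X8_sub]; ring

lemma CV_even (h0 : 0 < q) (h1 : q < 1) (a : ℤ) : CV q (2 * a) = VV q (2 * a) + yy q a := by
  rw [CV_sub h0 h1 (2 * a) a (fun j => by omega), yy, show 2 * a - 1 = -1 + 2 * a by ring, X8_add,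
    X8_neg_one, mul_one]

lemma CV_odd (h0 : 0 < q) (h1 : q < 1) (a : ℤ) :
    CV q (2 * a + 1) = VV q (2 * a + 1) - yy q (a + 1) := by
  rw [CV_sub h0 h1 (2 * a + 1) (a + 1) (fun j => by omega), yy,
    show 2 * a + 1 - 1 = 0 + 2 * a by ring, X8_add, X8_zero, sg_add, sg_one]
  ring

lemma U_mom (h0 : 0 < q) (h1 : q < 1) {h : ℤ → ℝ}
    (hs : Summable fun p : ℤ × ℤ => h (p.1 + (2 * p.2 + 1)) * (ell q p.1 * tt q p.2))
    (hV : Summable fun i => h i * VV q i) (y1 : Summable fun a => h (2 * a) * yy q a)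
    (y2 : Summable fun a => h (2 * a - 1) * yy q a) :
    ∑' i, h i * VV q i = ∑' p : ℤ × ℤ, h (p.1 + (2 * p.2 + 1)) * (ell q p.1 * tt q p.2)
      + ∑' a, (h (2 * a - 1) - h (2 * a)) * yy q a := by
  have sc := conv_summable (h := h) (s := fun n => 2 * n + 1) (f := ell q) (g := tt q) hs
  have C := conv_sum (h := h) (s := fun n => 2 * n + 1) (f := ell q) (g := tt q) hs
  simp_rw [← CV_def] at C sc
  have v1 : Summable fun a => h (2 * a) * VV q (2 * a) :=
    hV.comp_injective (i := fun a : ℤ => 2 * a) (fun a b hab => by simp only at hab; omega)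
  have v2 : Summable fun a => h (2 * a + 1) * VV q (2 * a + 1) :=
    hV.comp_injective (i := fun a : ℤ => 2 * a + 1) (fun a b hab => by simp only at hab; omega)
  have y2' : Summable fun a => h (2 * a + 1) * yy q (a + 1) := by
    refine ((Equiv.addRight (1 : ℤ)).summable_iff.2 y2).congr fun a => ?_
    simp only [Function.comp, Equiv.coe_addRight]
    rw [show 2 * (a + 1) - 1 = 2 * a + 1 by ring]
  have e2 : ∑' a, h (2 * a + 1) * yy q (a + 1) = ∑' a, h (2 * a - 1) * yy q a := by
    refine Eq.trans ?_ (tsum_shift (F := fun a => h (2 * a - 1) * yy q a) 1)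
    refine tsum_congr fun a => ?_
    rw [show 2 * (a + 1) - 1 = 2 * a + 1 by ring]
  rw [← C, tsum_even_odd sc, tsum_even_odd hV]
  simp_rw [CV_even h0 h1, CV_odd h0 h1, mul_add, mul_sub, sub_mul]
  rw [v1.tsum_add y1, v2.tsum_sub y2', e2, y2.tsum_sub y1]
  ring

noncomputable def L1 (q : ℝ) : ℝ := ∑' e : ℤ, (2 * e + 1 : ℝ) * ell q e
noncomputable def L3 (q : ℝ) : ℝ := ∑' e : ℤ, (2 * e + 1 : ℝ) ^ 3 * ell q e
noncomputable def T0 (q : ℝ) : ℝ := ∑' j : ℤ, tt q j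
noncomputable def T2 (q : ℝ) : ℝ := ∑' j : ℤ, (4 * j + 2 : ℝ) ^ 2 * tt q j

lemma Dec.lin2 {f : ℤ → ℝ} (hf : Dec f) (a b : ℝ) : Dec fun n => (a * n + b) ^ 2 * f n :=
  ((hf.mul_lin a b).mul_lin a b).congr fun n => by ring
lemma Dec.lin3 {f : ℤ → ℝ} (hf : Dec f) (a b : ℝ) : Dec fun n => (a * n + b) ^ 3 * f n :=
  ((hf.lin2 a b).mul_lin a b).congr fun n => by ring

lemma T0_Psi : T0 q = Psi (q ^ 4) := rfl

lemma two_sum_yy (h0 : 0 < q) (h1 : q < 1) : 2 * ∑' a, yy q a = T0 q := by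
  have s := (yy_dec h0 h1).summable
  have s' : Summable fun a : ℤ => yy q (a + 1) := (Equiv.addRight (1 : ℤ)).summable_iff.2 s
  rw [T0]
  simp_rw [← yy_rec h0 h1]
  rw [s.tsum_add s', tsum_shift 1]; ring

lemma T2_yy (h0 : 0 < q) (h1 : q < 1) : T2 q = ∑' a : ℤ, (32 * (a : ℝ) ^ 2 + 8) * yy q a := by
  have s := ((yy_dec h0 h1).lin2 4 2).summable
  have s2 := ((yy_dec h0 h1).lin2 4 (-2)).summable
  have s' : Summable fun a : ℤ => (4 * a + 2 : ℝ) ^ 2 * yy q (a + 1) := by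
    refine ((Equiv.addRight (1 : ℤ)).summable_iff.2 s2).congr fun a => ?_
    simp only [Function.comp, Equiv.coe_addRight]
    push_cast; ring
  have e : ∑' a : ℤ, (4 * a + 2 : ℝ) ^ 2 * yy q (a + 1) = ∑' a : ℤ, (4 * a + -2 : ℝ) ^ 2 * yy q a := by
    refine Eq.trans ?_ (tsum_shift (F := fun a : ℤ => (4 * a + -2 : ℝ) ^ 2 * yy q a) 1)
    refine tsum_congr fun a => ?_
    push_cast; ring
  rw [T2]
  simp_rw [← yy_rec h0 h1, mul_add]
  rw [s.tsum_add s', e, ← s.tsum_add s2]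
  refine tsum_congr fun a => ?_
  ring

lemma VV_dec (h0 : 0 < q) (h1 : q < 1) : Dec (VV q) :=
  ((decPsi' h0 h1).const_mul (VV q 0)).congr fun i => VV_eq h0 h1 i

lemma sum_ell0 (h0 : 0 < q) (h1 : q < 1) : ∑' e, ell q e = 0 :=
  tsum_refl_zero (-1) fun e => ell_refl h0 h1 e
lemma sum_ell2 (h0 : 0 < q) (h1 : q < 1) : ∑' e : ℤ, (2 * e + 1 : ℝ) ^ 2 * ell q e = 0 :=
  tsum_refl_zero (-1) fun e => by rw [ell_refl h0 h1]; push_cast; ring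

lemma U1 (h0 : 0 < q) (h1 : q < 1) : (L1 q - 1) * T0 q = VV q 0 * jj q := by
  have l := ell_dec h0 h1
  have t := tt_dec h0 h1
  have H := mom1 (u := fun n => 2 * (n : ℝ) + 1) (v := fun n => 4 * (n : ℝ) + 2) l (l.mul_lin 2 1)
    t (t.mul_lin 4 2)
  rw [sum_ell0 h0 h1, zero_mul, add_zero] at H
  have hs : Summable fun p : ℤ × ℤ =>
      (2 * ((p.1 + (2 * p.2 + 1) : ℤ) : ℝ) + 1) * (ell q p.1 * tt q p.2) :=
    H.summable.congr fun p => by push_cast; ring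
  have e : ∑' p : ℤ × ℤ, (2 * ((p.1 + (2 * p.2 + 1) : ℤ) : ℝ) + 1) * (ell q p.1 * tt q p.2)
      = L1 q * T0 q := by
    rw [L1, T0, ← H.tsum_eq]
    exact tsum_congr fun p => by push_cast; ring
  have y := yy_dec h0 h1
  have M := U_mom h0 h1 (h := fun n => 2 * (n : ℝ) + 1) hs ((VV_dec h0 h1).mul_lin 2 1).summable
    ((y.mul_lin 4 1).summable.congr fun a => by push_cast; ring)
    ((y.mul_lin 4 (-1)).summable.congr fun a => by push_cast; ring)
  rw [e] at M
  have e2 : ∑' a : ℤ, (2 * ((2 * a - 1 : ℤ) : ℝ) + 1 - (2 * ((2 * a : ℤ) : ℝ) + 1)) * yy q a = - T0 q := by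
    rw [← two_sum_yy h0 h1, ← neg_mul, ← tsum_mul_left]
    exact tsum_congr fun p => by push_cast; ring
  rw [e2] at M
  have e3 : ∑' i : ℤ, (2 * (i : ℝ) + 1) * VV q i = VV q 0 * jj q := by
    rw [jj, ← tsum_mul_left]
    exact tsum_congr fun i => by rw [VV_eq h0 h1 i]; ring
  rw [e3] at M
  linarith

lemma U3 (h0 : 0 < q) (h1 : q < 1) :
    (L3 q + 11) * T0 q + 3 * (L1 q - 1) * T2 q = VV q 0 * st3 q := by
  have l := ell_dec h0 h1
  have t := tt_dec h0 h1
  have H := mom3 (u := fun n => 2 * (n : ℝ) + 1) (v := fun n => 4 * (n : ℝ) + 2) l (l.mul_lin 2 1)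
    (l.lin2 2 1) (l.lin3 2 1) t (t.mul_lin 4 2) (t.lin2 4 2) (t.lin3 4 2)
  rw [sum_ell0 h0 h1, sum_ell2 h0 h1, zero_mul, zero_mul, mul_zero, add_zero, add_zero] at H
  have hs : Summable fun p : ℤ × ℤ =>
      (2 * ((p.1 + (2 * p.2 + 1) : ℤ) : ℝ) + 1) ^ 3 * (ell q p.1 * tt q p.2) :=
    H.summable.congr fun p => by push_cast; ring
  have e : ∑' p : ℤ × ℤ, (2 * ((p.1 + (2 * p.2 + 1) : ℤ) : ℝ) + 1) ^ 3 * (ell q p.1 * tt q p.2)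
      = L3 q * T0 q + 3 * (L1 q * T2 q) := by
    rw [L1, T0, L3, T2, ← H.tsum_eq]
    exact tsum_congr fun p => by push_cast; ring
  have y := yy_dec h0 h1
  have M := U_mom h0 h1 (h := fun n => (2 * (n : ℝ) + 1) ^ 3) hs ((VV_dec h0 h1).lin3 2 1).summable
    ((y.lin3 4 1).summable.congr fun a => by push_cast; ring)
    ((y.lin3 4 (-1)).summable.congr fun a => by push_cast; ring)
  rw [e] at M
  have s1 : Summable fun a : ℤ => (32 * (a : ℝ) ^ 2 + 8) * yy q a :=
    ((y.sq.const_mul 32).add (y.const_mul 8)).summable.congr fun a => by ring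
  have e2 : ∑' a : ℤ, ((2 * ((2 * a - 1 : ℤ) : ℝ) + 1) ^ 3 - (2 * ((2 * a : ℤ) : ℝ) + 1) ^ 3) * yy q a
      = 11 * T0 q - 3 * T2 q := by
    rw [← two_sum_yy h0 h1, T2_yy h0 h1, ← mul_assoc, ← tsum_mul_left, ← tsum_mul_left,
      ← (y.summable.mul_left _).tsum_sub (s1.mul_left _)]
    exact tsum_congr fun p => by push_cast; ring
  rw [e2] at M
  have e3 : ∑' i : ℤ, (2 * (i : ℝ) + 1) ^ 3 * VV q i = VV q 0 * st3 q := by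
    rw [st3, ← tsum_mul_left]
    exact tsum_congr fun i => by rw [VV_eq h0 h1 i]; ring
  rw [e3] at M
  linarith

lemma X8_hh (h0 : 0 < q) (h1 : q < 1) : ∑' i : ℤ, X8 i * q ^ (i ^ 2 + i) = 2 * hh (q ^ 2) := by
  have s : Summable fun i : ℤ => X8 i * q ^ (i ^ 2 + i) :=
    ((decPsi h0 h1).mono 1 zero_le_one fun n => by rw [abs_mul, abs_X8] :
      Dec fun i : ℤ => X8 i * q ^ (i ^ 2 + i)).summable
  rw [tsum_even_odd s, two_mul, hh]
  congr 1
  · refine tsum_congr fun m => ?_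
    rw [show 2 * m = 0 + 2 * m by ring, X8_add, X8_zero, sqz, mul_one]
    congr 2; ring
  · rw [← tsum_refl (-1)]
    refine tsum_congr fun m => ?_
    rw [show 2 * (-1 - m) + 1 = 1 + 2 * (-1 - m) by ring, X8_add, X8_one, sqz, sg_sub, sg_neg, sg_one,
      show (1 + 2 * (-1 - m)) ^ 2 + (1 + 2 * (-1 - m)) = 2 * (2 * m ^ 2 + m) by ring]
    ring

lemma U_const (h0 : 0 < q) (h1 : q < 1) : VV q 0 * (2 * hh (q ^ 2)) = - jj (q ^ 4) := by
  obtain ⟨l0, l1⟩ := q4_lt_one h0 h1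
  have l := ell_dec h0 h1
  have t := tt_dec h0 h1
  have y := yy_dec h0 h1
  have w1 : ∀ n : ℤ, |sg n * X8 n| = 1 := fun n => by rw [abs_mul, abs_sg, abs_X8, one_mul]
  have dl : Dec fun e => - (sg e * X8 (e + 1)) * ell q e := l.mono 1 zero_le_one fun n => by
    rw [abs_mul, abs_neg, abs_mul, abs_sg, abs_X8, one_mul]
  have dt : Dec fun j => sg j * tt q j := t.mono 1 zero_le_one fun n => by
    rw [abs_mul, abs_sg]
  have hp : ∀ p : ℤ × ℤ, sg (p.1 + (2 * p.2 + 1)) * X8 (p.1 + (2 * p.2 + 1)) * (ell q p.1 * tt q p.2)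
      = (- (sg p.1 * X8 (p.1 + 1)) * ell q p.1) * (sg p.2 * tt q p.2) := by
    intro p
    have e1 : X8 (p.1 + (2 * p.2 + 1)) = sg p.2 * X8 (p.1 + 1) := by
      rw [show p.1 + (2 * p.2 + 1) = (p.1 + 1) + 2 * p.2 by ring, X8_add]
    rw [e1, sg_add, sg_add, sg_two_mul, sg_one]; ring
  have hs : Summable fun p : ℤ × ℤ =>
      sg (p.1 + (2 * p.2 + 1)) * X8 (p.1 + (2 * p.2 + 1)) * (ell q p.1 * tt q p.2) :=
    (dl.mul_summable dt).congr fun p => (hp p).symm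
  have M := U_mom h0 h1 (h := fun n => sg n * X8 n) hs
    ((VV_dec h0 h1).mono 1 zero_le_one fun n => by rw [abs_mul, w1] :
      Dec fun n => sg n * X8 n * VV q n).summable
    (y.mono 1 zero_le_one fun n => by rw [abs_mul, w1] :
      Dec fun n => sg (2 * n) * X8 (2 * n) * yy q n).summable
    (y.mono 1 zero_le_one fun n => by rw [abs_mul, w1] :
      Dec fun n => sg (2 * n - 1) * X8 (2 * n - 1) * yy q n).summable
  simp_rw [hp] at M
  rw [← dl.tsum_mul dt, tt_alt, mul_zero, zero_add] at M
  have e2 : ∑' a : ℤ, (sg (2 * a - 1) * X8 (2 * a - 1) - sg (2 * a) * X8 (2 * a)) * yy q a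
      = - jj (q ^ 4) := by
    rw [← GG_sum l0 l1, ← neg_mul, ← tsum_mul_left]
    refine tsum_congr fun a => ?_
    have x1 : X8 (2 * a - 1) = sg a := by
      rw [show 2 * a - 1 = -1 + 2 * a by ring, X8_add, X8_neg_one, mul_one]
    have x2 : X8 (2 * a) = sg a := by
      rw [show 2 * a = 0 + 2 * a by ring, X8_add, X8_zero, mul_one]
    rw [x1, x2, sg_sub, sg_two_mul, sg_one, yy]
    linear_combination -2 * GG (q ^ 4) a * sg_mul_self a
  rw [e2] at M
  rw [← M, ← X8_hh h0 h1, ← tsum_mul_left]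
  refine tsum_congr fun i => ?_
  rw [VV_eq h0 h1 i]
  linear_combination - (VV q 0 * X8 i * q ^ (i ^ 2 + i)) * sg_mul_self i

lemma T2_eq (h0 : 0 < q) (h1 : q < 1) : q * T2 q = 2 * (A2 q - B2 q) := by
  have sa := (decA h0 h1).sq.summable
  have sb := (decB h0 h1).sq.summable
  rw [A2, B2, ← sa.tsum_sub sb, tsum_even_odd (sa.sub sb)]
  have z : ∀ n : ℤ, ((2 * n : ℤ) : ℝ) ^ 2 * q ^ ((2 * n) ^ 2)
      - ((2 * n : ℤ) : ℝ) ^ 2 * (sg (2 * n) * q ^ ((2 * n) ^ 2)) = 0 := fun n => by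
    rw [sg_two_mul]; ring
  simp_rw [z]
  rw [tsum_zero, zero_add, T2, ← tsum_mul_left, ← tsum_mul_left]
  refine tsum_congr fun j => ?_
  rw [tt_eq, sg_add, sg_two_mul, sg_one, show (2 * j + 1) ^ 2 = 1 + 4 * (j ^ 2 + j) by ring,
    zpow_add₀ h0.ne', zpow_one]
  push_cast
  ring

lemma L1_eq (h0 : 0 < q) (h1 : q < 1) :
    L1 q - 1 = - (thA (q ^ 2) * thA q * thB q * (thA q + thB q) / 2) := by
  obtain ⟨k0, k1⟩ := sq_lt_one h0 h1
  obtain ⟨l0, l1⟩ := q4_lt_one h0 h1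
  have a := U1 h0 h1
  have b := U_const h0 h1
  have c := Psi_gam h0 h1
  rw [T0_Psi] at a
  rw [jacobi h0 h1] at a
  rw [jacobi l0 l1] at b
  have d := A_split h0 h1
  have e := B_split h0 h1
  have pT := Psi_pos l0 l1
  have ph := hh_pos k0 k1
  have hC : thA (q ^ 4) = (thA q + thB q) / 2 := by linarith
  rw [hC] at b
  apply mul_right_cancel₀ (mul_pos pT ph).ne'
  linear_combination hh (q ^ 2) * a + Psi q * thA q * thB q / 2 * b
    - thA q * thB q * (thA q + thB q) / 4 * Psi (q ^ 4) * c

lemma L3_eq (h0 : 0 < q) (h1 : q < 1) :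
    L3 q + 11 = thA (q ^ 2) * thA q * thB q * (thA q + thB q) *
      (thA q ^ 4 + 3 * thA q ^ 3 * thB q + 3 * thA q ^ 2 * thB q ^ 2 + 3 * thA q * thB q ^ 3
        + thB q ^ 4) / 2 := by
  obtain ⟨l0, l1⟩ := q4_lt_one h0 h1
  have a := U1 h0 h1
  have b := U3 h0 h1
  have s := st3_eq h0 h1
  have t2 := T2_eq h0 h1
  have d := A_split h0 h1
  have e := B_split h0 h1
  rw [← T0_Psi] at d e
  have jd := jac_diff h0 h1
  have hL := L1_eq h0 h1
  rw [jacobi h0 h1] at a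
  have pA := A_pos h0 h1
  have pB := B_pos h0 h1
  have pP := Psi_pos h0 h1
  have pT : 0 < T0 q := Psi_pos l0 l1
  have h4 := qPsi4 h0 h1
  have p4 : 0 < thA q ^ 4 - thB q ^ 4 := by rw [← h4]; positivity
  have hT : T0 q = (thA q - thB q) / (2 * q) := by field_simp; linarith
  have hT2 : T2 q = 2 * (A2 q - B2 q) / q := by field_simp; linarith
  have hV : VV q 0 = (L1 q - 1) * T0 q / (Psi q * thA q * thB q) := by
    field_simp; linarith
  have hs : st3 q = (4 * Psi q * thA q * thB q *
      ((thA q ^ 3 * A2 q - thB q ^ 3 * B2 q)) +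
      4 * Psi q * (A2 q * thB q + thA q * B2 q) * (thA q ^ 4 - thB q ^ 4)) / (thA q ^ 4 - thB q ^ 4) := by
    rw [← s]; field_simp
  have hx : A2 q = (B2 q / thB q + (thA q ^ 4 - thB q ^ 4) / 4) * thA q := by
    field_simp; linear_combination 4 * jd
  rw [hV, hs, hT, hT2, hL, hx] at b
  have dAB : 0 < thA q - thB q := by
    have : thA q - thB q = 2 * q * T0 q := by linarith
    rw [this]; positivity
  have b' : L3 q + 11 = ((L3 q + 11) * ((thA q - thB q) / (2 * q))) * (2 * q / (thA q - thB q)) := by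
    field_simp
  rw [b', eq_sub_of_add_eq b]
  have p4' : thA q ^ 4 - thB q ^ 4 = (thA q - thB q) * (thA q + thB q) * (thA q ^ 2 + thB q ^ 2) := by ring
  rw [p4']
  have hAB : 0 < thA q ^ 2 + thB q ^ 2 := by positivity
  have hAB' : 0 < thA q + thB q := by positivity
  generalize thA q = A at *
  generalize thB q = B at *
  generalize hD : A - B = D at *
  have : A = D + B := by linarith
  subst this
  field_simp
  ring

end
end Rep


namespace Rep
open Filter Topology

section
variable {q : ℝ}

/-- A power series vanishing on `(0,1)` has zero coefficients. -/
lemma coeff_zero {c : ℕ → ℝ} (h : ∀ q : ℝ, 0 < q → q < 1 → HasSum (fun n => c n * q ^ n) 0) :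
    ∀ n, c n = 0 := by
  intro n
  induction n using Nat.strong_induction_on with
  | _ n ih =>
  have key : ∀ q : ℝ, 0 < q → q < 1 → HasSum (fun k => c (k + n) * q ^ k) 0 := by
    intro q h0 h1
    have a := h q h0 h1
    rw [← hasSum_nat_add_iff' n, Finset.sum_eq_zero (fun i hi => by
      rw [ih i (Finset.mem_range.1 hi), zero_mul]), sub_zero] at a
    have b := a.mul_left (q ^ n)⁻¹
    rw [mul_zero] at b
    have hq : q ^ n ≠ 0 := by positivity
    refine hs_congr b (fun k => ?_) rfl
    rw [pow_add]; field_simp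
  have k2 := (key (1 / 2) (by norm_num) (by norm_num)).summable
  have k3 : Summable fun k => |c (k + 1 + n)| * (1 / 2 : ℝ) ^ k := by
    have := ((summable_nat_add_iff 1).2 k2).norm.mul_left 2
    refine this.congr fun k => ?_
    rw [Real.norm_eq_abs, abs_mul, abs_of_pos (show (0 : ℝ) < (1 / 2) ^ (k + 1) by positivity), pow_succ]
    ring
  have bound : ∀ q : ℝ, 0 < q → q ≤ 1 / 2 → |c n| ≤ q * ∑' k, |c (k + 1 + n)| * (1 / 2 : ℝ) ^ k := by
    intro q h0 h1
    have a := key q h0 (by linarith)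
    rw [← hasSum_nat_add_iff' 1] at a
    simp only [Finset.range_one, Finset.sum_singleton, pow_zero, mul_one, zero_add, zero_sub] at a
    have := tsum_of_norm_bounded (k3.mul_left q).hasSum (f := fun k => c (k + 1 + n) * q ^ (k + 1))
      (fun k => by
        rw [Real.norm_eq_abs, abs_mul, abs_of_pos (show 0 < q ^ (k + 1) by positivity), pow_succ]
        have : q ^ k ≤ (1 / 2) ^ k := pow_le_pow_left₀ h0.le h1 k
        have := mul_le_mul_of_nonneg_left this (mul_nonneg h0.le (abs_nonneg (c (k + 1 + n))))
        linarith)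
    rw [a.tsum_eq, tsum_mul_left, norm_neg, Real.norm_eq_abs] at this
    exact this
  set S := ∑' k, |c (k + 1 + n)| * (1 / 2 : ℝ) ^ k with hS
  have S0 : 0 ≤ S := tsum_nonneg fun k => by positivity
  by_contra hne
  have hpos : 0 < |c n| := abs_pos.2 hne
  have hq : 0 < min (1 / 2) (|c n| / (2 * (S + 1))) := lt_min (by norm_num) (by positivity)
  have := bound _ hq (min_le_left _ _)
  have h2 : min (1 / 2) (|c n| / (2 * (S + 1))) * S ≤ |c n| / (2 * (S + 1)) * S :=
    mul_le_mul_of_nonneg_right (min_le_right _ _) S0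
  have h3 : |c n| / (2 * (S + 1)) * S < |c n| := by
    rw [div_mul_eq_mul_div, div_lt_iff₀ (by positivity)]
    nlinarith
  linarith

lemma half_series {f : ℕ → ℝ} {s : ℝ} (h : HasSum (fun n => f n * (q ^ 2) ^ n) s) :
    HasSum (fun n => (if 2 ∣ n then f (n / 2) else 0) * q ^ n) s := by
  have inj : Function.Injective fun n : ℕ => 2 * n := fun a b hab => by simp only at hab; omega
  rw [← inj.hasSum_iff]
  · refine hs_congr h (fun n => ?_) rfl
    simp [pow_mul]
  · intro n hn
    rw [if_neg, zero_mul]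
    rintro ⟨k, rfl⟩
    exact hn ⟨k, rfl⟩

lemma lambert (h0 : 0 < q) (h1 : q < 1) {w : ℕ → ℕ → ℝ} (hw : ∀ d m, |w d m| ≤ (d : ℝ) ^ 3) :
    HasSum (fun n : ℕ => (∑ d ∈ n.divisors, w d (n / d)) * q ^ n)
      (∑' d : ℕ+, ∑' m : ℕ+, w d m * q ^ (m * d : ℕ)) := by
  have S0 := summable_prod_mul_pow (𝕜 := ℝ) 3 (r := q) (by rwa [Real.norm_eq_abs, abs_of_pos h0])
  have S : Summable fun c : ℕ+ × ℕ+ => w c.2 c.1 * q ^ (c.1 * c.2 : ℕ) :=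
    Summable.of_norm_bounded S0 fun c => by
      rw [Real.norm_eq_abs, abs_mul, abs_of_pos (show 0 < q ^ (c.1 * c.2 : ℕ) by positivity)]
      exact mul_le_mul_of_nonneg_right (hw _ _) (by positivity)
  have S' : Summable fun c : ℕ+ × ℕ+ => w c.1 c.2 * q ^ (c.2 * c.1 : ℕ) := S.prod_symm
  rw [← S'.tsum_prod]
  have e1 : ∑' c : ℕ+ × ℕ+, w c.1 c.2 * q ^ (c.2 * c.1 : ℕ)
      = ∑' c : ℕ+ × ℕ+, w c.2 c.1 * q ^ (c.1 * c.2 : ℕ) :=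
    (Equiv.prodComm ℕ+ ℕ+).tsum_eq (fun c : ℕ+ × ℕ+ => w c.2 c.1 * q ^ (c.1 * c.2 : ℕ))
  rw [e1]
  have H := (sigmaAntidiagonalEquivProd.hasSum_iff.2 S.hasSum).sigma
    (g := fun n : ℕ+ => (∑ d ∈ (n : ℕ).divisors, w d ((n : ℕ) / d)) * q ^ (n : ℕ)) (fun n => by
      refine hs_congr (hasSum_fintype _) (fun _ => rfl) ?_
      have e2 : ∀ x : {x // x ∈ (n : ℕ).divisorsAntidiagonal},
          ((fun c : ℕ+ × ℕ+ => w c.2 c.1 * q ^ (c.1 * c.2 : ℕ)) ∘ sigmaAntidiagonalEquivProd) ⟨n, x⟩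
          = w x.1.2 x.1.1 * q ^ (n : ℕ) := by
        intro x
        have := (Nat.mem_divisorsAntidiagonal.1 x.2).1
        simp [sigmaAntidiagonalEquivProd, divisorsAntidiagonalFactors, this]
      rw [Finset.sum_congr rfl fun x _ => e2 x, ← Finset.sum_mul]
      congr 1
      rw [Finset.sum_coe_sort (n : ℕ).divisorsAntidiagonal (fun x => w x.2 x.1),
        Nat.sum_divisorsAntidiagonal' (f := fun a b => w b a)])
  refine (Function.Injective.hasSum_iff PNat.coe_injective ?_).1 H
  intro n hn
  have : n = 0 := by
    by_contra h
    exact hn ⟨⟨n, Nat.pos_of_ne_zero h⟩, rfl⟩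
  subst this
  simp

lemma lambert_nat {F : ℕ → ℝ} {s : ℝ} (h : HasSum F s) (hz : F 0 = 0) : ∑' d : ℕ+, F d = s := by
  have : HasSum (fun d : ℕ+ => F d) s := by
    refine (Function.Injective.hasSum_iff PNat.coe_injective ?_).2 h
    intro n hn
    have : n = 0 := by
      by_contra h
      exact hn ⟨⟨n, Nat.pos_of_ne_zero h⟩, rfl⟩
    rw [this, hz]
  exact this.tsum_eq

end
end Rep


namespace Rep
open Filter Topology

section
variable {q : ℝ}

noncomputable def c8 (m : ℕ) : ℝ := ((ZMod.χ₈ (m : ZMod 8) : ℤ) : ℝ)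

lemma c8_eq (m : ℕ) : c8 m = if m % 2 = 0 then 0 else if m % 8 = 1 ∨ m % 8 = 7 then 1 else -1 := by
  rw [c8, ZMod.χ₈_nat_eq_if_mod_eight]
  split_ifs <;> simp

lemma c8_abs (m : ℕ) : |c8 m| ≤ 1 := by
  rw [c8_eq]; split_ifs <;> simp

lemma c8_four (m : ℕ) : c8 (m + 4) = - c8 m := by
  rw [c8_eq, c8_eq]
  split_ifs <;> first | omega | simp

lemma c8_sum {x : ℝ} (h0 : 0 < x) (h1 : x < 1) :
    HasSum (fun m => c8 m * x ^ m) ((x - x ^ 3) / (1 + x ^ 4)) := by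
  have S : Summable fun m => c8 m * x ^ m :=
    Summable.of_norm_bounded (summable_geometric_of_lt_one h0.le h1) fun m => by
      rw [Real.norm_eq_abs, abs_mul, abs_of_pos (show 0 < x ^ m by positivity)]
      have := mul_le_mul_of_nonneg_right (c8_abs m) (show 0 ≤ x ^ m by positivity)
      linarith
  have a := S.sum_add_tsum_nat_add 4
  have b : ∑' m, c8 (m + 4) * x ^ (m + 4) = - x ^ 4 * ∑' m, c8 m * x ^ m := by
    rw [← tsum_mul_left]
    exact tsum_congr fun m => by rw [c8_four]; ring
  rw [b] at a
  have e0 : c8 0 = 0 := by simp [c8_eq]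
  have e1 : c8 1 = 1 := by simp [c8_eq]
  have e2 : c8 2 = 0 := by simp [c8_eq]
  have e3 : c8 3 = -1 := by simp [c8_eq]
  simp only [Finset.sum_range_succ, Finset.sum_range_zero, e0, e1, e2, e3] at a
  refine hs_congr S.hasSum (fun _ => rfl) ?_
  have : 0 < 1 + x ^ 4 := by positivity
  rw [div_eq_iff this.ne']
  linarith

lemma geom_sum {x : ℝ} (h0 : 0 < x) (h1 : x < 1) : ∑' m : ℕ+, x ^ (m : ℕ) = x / (1 - x) := by
  have a := (hasSum_geometric_of_lt_one h0.le h1).mul_left x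
  have b : HasSum (fun n : ℕ => if n = 0 then 0 else x ^ n) (x / (1 - x)) := by
    rw [← hasSum_nat_add_iff' 1]
    refine hs_congr a (fun n => by simp [pow_succ']) (by simp [div_eq_mul_inv])
  rw [← lambert_nat b (by simp)]
  exact tsum_congr fun m => by simp

lemma M3_series (h0 : 0 < q) (h1 : q < 1) :
    HasSum (fun n : ℕ => (∑ d ∈ n.divisors, c8 (n / d) * (d : ℝ) ^ 3) * q ^ n) (M3 q / 2) := by
  have H := lambert h0 h1 (w := fun d m => c8 m * (d : ℝ) ^ 3) (fun d m => by
    rw [abs_mul, abs_of_nonneg (show (0 : ℝ) ≤ (d : ℝ) ^ 3 by positivity)]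
    have := mul_le_mul_of_nonneg_right (c8_abs m) (show (0 : ℝ) ≤ (d : ℝ) ^ 3 by positivity)
    linarith)
  refine hs_congr H (fun _ => rfl) ?_
  have ev := tsum_int_eq_zero_add_two_mul_tsum_pnat (f := fun d : ℤ => (d : ℝ) ^ 3 * lam q d)
    (fun d => by beta_reduce; rw [lam_odd h0]; push_cast; ring) (lam_dec h0 h1).cube.summable
  rw [← M3] at ev
  simp only [Int.cast_zero] at ev
  have e2 : ∀ d : ℕ+, ∑' m : ℕ+, c8 m * ((d : ℕ) : ℝ) ^ 3 * q ^ (m * d : ℕ)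
      = (((d : ℕ) : ℤ) : ℝ) ^ 3 * lam q ((d : ℕ) : ℤ) := by
    intro d
    have hx0 : 0 < q ^ (d : ℕ) := by positivity
    have hx1 : q ^ (d : ℕ) < 1 := pow_lt_one₀ h0.le h1 d.ne_zero
    have := lambert_nat (c8_sum hx0 hx1) (by simp [c8_eq])
    rw [lam, mul_comm (3 : ℤ), mul_comm (4 : ℤ), zpow_mul, zpow_mul, zpow_natCast]
    have t3 : (q ^ (d : ℕ)) ^ (3 : ℤ) = (q ^ (d : ℕ)) ^ 3 := by norm_cast
    have t4 : (q ^ (d : ℕ)) ^ (4 : ℤ) = (q ^ (d : ℕ)) ^ 4 := by norm_cast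
    rw [t3, t4, ← this, ← tsum_mul_left]
    refine tsum_congr fun m => ?_
    rw [mul_comm (m : ℕ), pow_mul]; push_cast; ring
  simp_rw [e2]
  rw [ev]
  simp

lemma c8_odd (e : ℕ) : c8 (2 * e + 1) = X8 (e : ℤ) := by
  rw [c8_eq, X8, if_neg (by omega)]
  by_cases h : ((e : ℤ) % 4 = 0 ∨ (e : ℤ) % 4 = 3)
  · rw [if_pos h, if_pos (by omega)]
  · rw [if_neg h, if_neg (by omega)]

lemma L3_series (h0 : 0 < q) (h1 : q < 1) :
    HasSum (fun n : ℕ => (∑ d ∈ n.divisors, c8 d * (d : ℝ) ^ 3) * (q ^ 2) ^ n) (L3 q / 2) := by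
  obtain ⟨k0, k1⟩ := sq_lt_one h0 h1
  have H := lambert k0 k1 (w := fun d m => c8 d * (d : ℝ) ^ 3) (fun d m => by
    rw [abs_mul, abs_of_nonneg (show (0 : ℝ) ≤ (d : ℝ) ^ 3 by positivity)]
    have := mul_le_mul_of_nonneg_right (c8_abs d) (show (0 : ℝ) ≤ (d : ℝ) ^ 3 by positivity)
    linarith)
  refine hs_congr H (fun _ => rfl) ?_
  have s := ((ell_dec h0 h1).lin3 2 1).summable
  have s1 : Summable fun n : ℕ => (2 * ((n : ℤ) : ℝ) + 1) ^ 3 * ell q n :=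
    s.comp_injective (i := fun n : ℕ => (n : ℤ)) Nat.cast_injective
  have er : ∀ n : ℕ, (2 * ((-((n : ℤ) + 1) : ℤ) : ℝ) + 1) ^ 3 * ell q (-((n : ℤ) + 1))
      = (2 * ((n : ℤ) : ℝ) + 1) ^ 3 * ell q n := by
    intro n
    rw [show -((n : ℤ) + 1) = -1 - n by ring, ell_refl h0 h1]; push_cast; ring
  have ev := tsum_of_nat_of_neg_add_one (f := fun e : ℤ => (2 * (e : ℝ) + 1) ^ 3 * ell q e) s1
    (s1.congr fun n => (er n).symm)
  rw [← L3] at ev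
  simp_rw [er] at ev
  have e2 : ∀ d : ℕ+, ∑' m : ℕ+, c8 d * ((d : ℕ) : ℝ) ^ 3 * (q ^ 2) ^ (m * d : ℕ)
      = (fun d : ℕ => c8 d * (d : ℝ) ^ 3 * ((q ^ 2) ^ d / (1 - (q ^ 2) ^ d))) d := by
    intro d
    have hx0 : 0 < (q ^ 2) ^ (d : ℕ) := by positivity
    have hx1 : (q ^ 2) ^ (d : ℕ) < 1 := pow_lt_one₀ k0.le k1 d.ne_zero
    simp only
    rw [← geom_sum hx0 hx1, ← tsum_mul_left]
    refine tsum_congr fun m => ?_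
    rw [mul_comm (m : ℕ), pow_mul]
  simp_rw [e2]
  have inj : Function.Injective fun n : ℕ => 2 * n + 1 := fun a b hab => by simp only at hab; omega
  have K : HasSum (fun d : ℕ => c8 d * (d : ℝ) ^ 3 * ((q ^ 2) ^ d / (1 - (q ^ 2) ^ d)))
      (∑' n : ℕ, (2 * ((n : ℤ) : ℝ) + 1) ^ 3 * ell q n) := by
    rw [← inj.hasSum_iff]
    · refine hs_congr s1.hasSum (fun e => ?_) rfl
      simp only [Function.comp]
      rw [c8_odd, ell, if_neg (by omega), add_zero, muu]
      have : q ^ (2 * (2 * (e : ℤ) + 1)) = (q ^ 2) ^ (2 * e + 1) := by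
        rw [← pow_mul, ← zpow_natCast]; push_cast; rfl
      rw [this]; push_cast; ring
    · intro n hn
      have : n % 2 = 0 := by
        by_contra h
        exact hn ⟨n / 2, by simp only; omega⟩
      rw [c8_eq, if_pos this]; ring
  rw [lambert_nat K (by simp [c8_eq]), ev]
  ring

end
end Rep

set_option autoImplicit false
namespace Rep
variable {q : ℝ}

noncomputable def F1 (q : ℝ) : ℝ :=
  q * (EE q ^ (-2 : ℤ) * EE (q ^ 2) ^ (11 : ℤ) * EE (q ^ 4) ^ (-3 : ℤ) * EE (q ^ 8) ^ (2 : ℤ))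
noncomputable def F2 (q : ℝ) : ℝ :=
  q * (EE q ^ (2 : ℤ) * EE (q ^ 2) ^ (-3 : ℤ) * EE (q ^ 4) ^ (11 : ℤ) * EE (q ^ 8) ^ (-2 : ℤ))

lemma EE_pos (h0 : 0 < q) (h1 : q < 1) : 0 < EE q := (EE_lim h0 h1).2

lemma EF (h0 : 0 < q) (h1 : q < 1) :
    F1 q = thA (q ^ 2) * thA q ^ 3 * thB q ^ 2 * (q * Psi (q ^ 2) ^ 2) / 4 ∧
    F2 q = thA (q ^ 2) ^ 3 * thA q * thB q ^ 2 * (q * Psi (q ^ 2) ^ 2) / 4 := by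
  have k0 : 0 < q ^ 2 := by positivity
  have k1 : q ^ 2 < 1 := pow_lt_one₀ h0.le h1 (by norm_num)
  have e1 := EE_pos h0 h1
  have e2 := EE_pos k0 k1
  have e4 : 0 < EE (q ^ 4) := EE_pos (by positivity) (pow_lt_one₀ h0.le h1 (by norm_num))
  have e8 : 0 < EE (q ^ 8) := EE_pos (by positivity) (pow_lt_one₀ h0.le h1 (by norm_num))
  have hB := B_E h0 h1
  have hA := A_E h0 h1
  have hb := A_E k0 k1
  have hP := Psi_E k0 k1
  have t1 : (q ^ 2) ^ 2 = q ^ 4 := by ring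
  have t2 : (q ^ 2) ^ 4 = q ^ 8 := by ring
  rw [t1, t2] at hb hP
  have hB' : thB q = EE q ^ 2 / EE (q ^ 2) := by rw [eq_div_iff e2.ne']; exact hB
  have hA' : thA q = EE (q ^ 2) ^ 5 / (EE q ^ 2 * EE (q ^ 4) ^ 2) := by
    rw [eq_div_iff (by positivity)]; linarith
  have hb' : thA (q ^ 2) = EE (q ^ 4) ^ 5 / (EE (q ^ 2) ^ 2 * EE (q ^ 8) ^ 2) := by
    rw [eq_div_iff (by positivity)]; linarith
  have hP' : Psi (q ^ 2) = 2 * EE (q ^ 8) ^ 2 / EE (q ^ 4) := by rw [eq_div_iff e4.ne']; exact hP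
  rw [hB', hA', hb', hP', F1, F2]
  have p1 : ∀ x : ℝ, x ^ (-2 : ℤ) = (x ^ 2)⁻¹ := fun x => by rw [zpow_neg]; norm_cast
  have p2 : ∀ x : ℝ, x ^ (-3 : ℤ) = (x ^ 3)⁻¹ := fun x => by rw [zpow_neg]; norm_cast
  have p3 : ∀ x : ℝ, x ^ (11 : ℤ) = x ^ 11 := fun x => by norm_cast
  have p4 : ∀ x : ℝ, x ^ (2 : ℤ) = x ^ 2 := fun x => by norm_cast
  simp only [p1, p2, p3, p4]
  generalize EE q = a at *
  generalize EE (q ^ 2) = b at *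
  generalize EE (q ^ 4) = c at *
  generalize EE (q ^ 8) = d at *
  constructor
  · field_simp
    try ring
  · field_simp
    try ring

lemma main_id (h0 : 0 < q) (h1 : q < 1) :
    11 * (thA q * thA (q ^ 2) ^ 3 * thA (q ^ 4) ^ 4) =
      11 + 2 * M3 q + L3 q + F1 q + 17 * F2 q + 48 * F1 (q ^ 2) + 16 * F2 (q ^ 2) := by
  have k0 : 0 < q ^ 2 := by positivity
  have k1 : q ^ 2 < 1 := pow_lt_one₀ h0.le h1 (by norm_num)
  obtain ⟨f1, f2⟩ := EF h0 h1
  obtain ⟨g1, g2⟩ := EF k0 k1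
  have hM := M3_eq h0 h1
  have hL := L3_eq h0 h1
  have hAs := A_sq h0 h1
  have hBs := B_sq h0 h1
  have hAB := AB_eq h0 h1
  have s1 := A_split h0 h1
  have s2 := B_split h0 h1
  have t1 : (q ^ 2) ^ 2 = q ^ 4 := by ring
  rw [t1] at g1 g2
  have hC : thA (q ^ 4) = (thA q + thB q) / 2 := by linarith
  have hP4 : q ^ 2 * Psi (q ^ 4) ^ 2 = ((thA q - thB q) / 2) ^ 2 := by
    have : (thA q - thB q) / 2 = q * Psi (q ^ 4) := by linarith
    rw [this]; ring
  have hP2 : q * Psi (q ^ 2) ^ 2 = (thA q ^ 2 - thB q ^ 2) / 2 := by linarith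
  have hb : thA (q ^ 2) ^ 2 = (thA q ^ 2 + thB q ^ 2) / 2 := by linarith
  have hb3 : thA (q ^ 2) ^ 3 = (thA q ^ 2 + thB q ^ 2) / 2 * thA (q ^ 2) := by rw [← hb]; ring
  rw [f1, f2, g1, g2, hP4, hP2, ← hAB, hC, hb3, hM, show L3 q = (L3 q + 11) - 11 by ring, hL]
  ring

end Rep

set_option autoImplicit false
namespace Rep

lemma prod_hs : ∀ (n : ℕ) (f : Fin n → ℤ → ℝ) (s : Fin n → ℝ), (∀ i m, 0 ≤ f i m) →
    (∀ i, HasSum (f i) (s i)) → HasSum (fun x : Fin n → ℤ => ∏ i, f i (x i)) (∏ i, s i) := by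
  intro n
  induction n with
  | zero =>
    intro f s _ _
    simp only [Finset.univ_eq_empty, Finset.prod_empty]
    have := hasSum_fintype (fun _ : Fin 0 → ℤ => (1 : ℝ))
    simpa using this
  | succ n ih =>
    intro f s hf hs
    have h1 := ih (fun i => f i.succ) (fun i => s i.succ) (fun i m => hf _ m) (fun i => hs _)
    have hsm : Summable fun x : ℤ × (Fin n → ℤ) => f 0 x.1 * ∏ i : Fin n, f i.succ (x.2 i) :=
      Summable.mul_of_nonneg (f := f 0) (g := fun x : Fin n → ℤ => ∏ i : Fin n, f i.succ (x i))
        (hs 0).summable h1.summable (fun m => hf 0 m)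
        (fun x => Finset.prod_nonneg fun i _ => hf _ _)
    have h2 := (hs 0).mul h1 hsm
    rw [← (Fin.consEquiv (fun _ : Fin (n + 1) => ℤ)).hasSum_iff]
    refine hs_congr h2 (fun x => ?_) ?_
    · simp [Fin.prod_univ_succ, Fin.consEquiv]
    · rw [Fin.prod_univ_succ]

lemma fiber_hs {α : Type*} (N : α → ℕ) {q s : ℝ} (hq : 0 < q)
    (h : HasSum (fun x => q ^ N x) s) :
    HasSum (fun n : ℕ => (Nat.card {x : α // N x = n} : ℝ) * q ^ n) s := by
  have h1 := (Equiv.sigmaFiberEquiv N).hasSum_iff.2 h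
  have e : ∀ n : ℕ, HasSum (fun c : {x : α // N x = n} => ((fun x => q ^ N x) ∘ (Equiv.sigmaFiberEquiv N)) ⟨n, c⟩)
      ((Nat.card {x : α // N x = n} : ℝ) * q ^ n) := by
    intro n
    have hc : ∀ c : {x : α // N x = n},
        ((fun x => q ^ N x) ∘ (Equiv.sigmaFiberEquiv N)) ⟨n, c⟩ = q ^ n := by
      rintro ⟨c, hc⟩
      simp [Equiv.sigmaFiberEquiv, hc]
    have sm := h1.summable.sigma_factor n
    have := sm.hasSum
    refine hs_congr this (fun _ => rfl) ?_
    rw [tsum_congr hc, tsum_const, nsmul_eq_mul]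
  exact h1.sigma e

lemma thA_hs {q : ℝ} (h0 : 0 < q) (h1 : q < 1) (k : ℕ) (hk : k ≠ 0) :
    HasSum (fun m : ℤ => q ^ (k * (m ^ 2).toNat)) (thA (q ^ k)) := by
  have := (decA (q := q ^ k) (by positivity) (pow_lt_one₀ h0.le h1 hk)).summable.hasSum
  rw [← thA] at this
  refine hs_congr this (fun m => ?_) rfl
  rw [pow_mul, ← zpow_natCast (q ^ k), Int.toNat_of_nonneg (by positivity)]

lemma theta_hs {q : ℝ} (h0 : 0 < q) (h1 : q < 1) (a : Fin 8 → ℕ) (ha : ∀ i, a i ≠ 0) :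
    HasSum (fun n : ℕ => (Nat.card {x : Fin 8 → ℤ // ∑ i, (a i : ℤ) * x i ^ 2 = (n : ℤ)} : ℝ) * q ^ n)
      (∏ i, thA (q ^ a i)) := by
  have h := prod_hs 8 (fun i m => q ^ (a i * (m ^ 2).toNat)) (fun i => thA (q ^ a i))
    (fun i m => by positivity) (fun i => thA_hs h0 h1 _ (ha i))
  have h2 : HasSum (fun x : Fin 8 → ℤ => q ^ (∑ i, a i * (x i ^ 2).toNat)) (∏ i, thA (q ^ a i)) :=
    hs_congr h (fun x => by rw [Finset.prod_pow_eq_pow_sum]) rfl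
  refine hs_congr (fiber_hs _ h0 h2) (fun n => ?_) rfl
  congr 2
  refine Nat.card_congr (Equiv.subtypeEquivRight fun x => ?_)
  rw [← Int.natCast_inj]
  push_cast
  have : ∀ i, (((x i ^ 2).toNat : ℕ) : ℤ) = x i ^ 2 := fun i => Int.toNat_of_nonneg (by positivity)
  simp [this]

end Rep

open Complex Real Finset

lemma Rep.eta_real {t : ℝ} (ht : 0 < t) :
    dedekindEta (Complex.I * t) = ((Real.exp (-(Real.pi * t / 12)) * Rep.EE (Real.exp (-(2 * Real.pi * t))) : ℝ) : ℂ) := by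
  have q0 := Real.exp_pos (-(2 * Real.pi * t))
  have q1 : Real.exp (-(2 * Real.pi * t)) < 1 := by
    rw [Real.exp_lt_one_iff]; have := Real.pi_pos; have : 0 < 2 * Real.pi * t := by positivity
    linarith
  have I2 := Complex.I_mul_I
  rw [dedekindEta, Complex.ofReal_mul]
  congr 1
  · rw [Complex.ofReal_exp]; congr 1; push_cast
    linear_combination ((Real.pi : ℂ) * t / 12) * I2
  · have e : ∀ m : ℕ, (1 - Complex.exp (2 * Real.pi * Complex.I * (m + 1) * (Complex.I * t)))
        = ((1 - Real.exp (-(2 * Real.pi * t)) ^ (m + 1) : ℝ) : ℂ) := by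
      intro m
      rw [← Real.exp_nat_mul, Complex.ofReal_sub, Complex.ofReal_one, Complex.ofReal_exp]
      congr 2; push_cast
      linear_combination (2 * (Real.pi : ℂ) * t * (m + 1)) * I2
    rw [tprod_congr e]
    have hm : Multipliable fun m : ℕ => 1 - Real.exp (-(2 * Real.pi * t)) ^ (m + 1) := by
      have := multipliable_one_add_of_summable (f := fun k : ℕ => -1 * Real.exp (-(2 * Real.pi * t)) ^ (1 * k + 1))
        (Rep.summable_neg_pow q0 q1 1 1 (-1) one_ne_zero).norm
      refine this.congr fun k => ?_
      ring
    have := hm.hasProd.map Complex.ofRealHom Complex.continuous_ofReal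
    exact this.tprod_eq

lemma Rep.eta_k {t q : ℝ} (ht : 0 < t) (hq : q = Real.exp (-(2 * Real.pi * t))) (k : ℕ) (hk : 0 < k) :
    dedekindEta (k * (Complex.I * t)) = ((Real.exp (-(Real.pi * t / 12)) ^ k * Rep.EE (q ^ k) : ℝ) : ℂ) := by
  have : (k : ℂ) * (Complex.I * t) = Complex.I * ((k * t : ℝ) : ℂ) := by push_cast; ring
  rw [this, Rep.eta_real (by positivity), hq, ← Real.exp_nat_mul, ← Real.exp_nat_mul]
  congr 4 <;> ring_nf

lemma Rep.series_of {a : ℕ → ℤ} {q F : ℝ} (hF : F ≠ 0)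
    (h : (F : ℂ) = ∑' m : ℕ, (a (m + 1) : ℂ) * (q : ℂ) ^ (m + 1)) :
    HasSum (fun n : ℕ => (if n = 0 then 0 else (a n : ℝ)) * q ^ n) F := by
  have h2 : (F : ℂ) = ((∑' m : ℕ, (a (m + 1) : ℝ) * q ^ (m + 1) : ℝ) : ℂ) := by
    rw [h, Complex.ofReal_tsum]; push_cast; rfl
  have h3 : F = ∑' m : ℕ, (a (m + 1) : ℝ) * q ^ (m + 1) := Complex.ofReal_injective h2
  have sm : Summable fun m : ℕ => (a (m + 1) : ℝ) * q ^ (m + 1) := by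
    by_contra hc
    rw [tsum_eq_zero_of_not_summable hc] at h3
    exact hF h3
  have hs := sm.hasSum
  rw [← h3] at hs
  rw [← hasSum_nat_add_iff' 1]
  refine Rep.hs_congr hs (fun n => by simp) (by simp)

lemma Rep.exists_t {q : ℝ} (h0 : 0 < q) (h1 : q < 1) :
    ∃ t : ℝ, 0 < t ∧ q = Real.exp (-(2 * Real.pi * t)) := by
  have := Real.pi_pos
  refine ⟨-Real.log q / (2 * Real.pi), ?_, ?_⟩
  · have := Real.log_neg h0 h1
    have : 0 < -Real.log q := by linarith
    positivity
  · have e : -(2 * Real.pi * (-Real.log q / (2 * Real.pi))) = Real.log q := by field_simp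
    rw [e, Real.exp_log h0]

lemma Rep.exp_q {t q : ℝ} (hq : q = Real.exp (-(2 * Real.pi * t))) :
    Complex.exp (2 * Real.pi * Complex.I * (Complex.I * t)) = (q : ℂ) := by
  rw [hq, Complex.ofReal_exp]; congr 1; push_cast
  linear_combination (2 * (Real.pi : ℂ) * t) * Complex.I_mul_I

lemma Rep.a_series {a : ℕ → ℤ} (k1 k2 k4 k8 : ℤ) (hk : k1 + 2 * k2 + 4 * k4 + 8 * k8 = 24)
    (ha : ∀ z : ℂ, 0 < z.im →
      dedekindEta z ^ k1 * dedekindEta (2 * z) ^ k2 * dedekindEta (4 * z) ^ k4 * dedekindEta (8 * z) ^ k8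
        = ∑' m : ℕ, (a (m + 1) : ℂ) * Complex.exp (2 * Real.pi * Complex.I * z) ^ (m + 1))
    {q : ℝ} (h0 : 0 < q) (h1 : q < 1) :
    HasSum (fun n : ℕ => (if n = 0 then 0 else (a n : ℝ)) * q ^ n)
      (q * (Rep.EE q ^ k1 * Rep.EE (q ^ 2) ^ k2 * Rep.EE (q ^ 4) ^ k4 * Rep.EE (q ^ 8) ^ k8)) := by
  obtain ⟨t, ht, hq⟩ := Rep.exists_t h0 h1
  have H := ha (Complex.I * t) (by simpa using ht)
  rw [Rep.exp_q hq] at H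
  have e1 := Rep.eta_k ht hq 1 (by norm_num)
  have e2 := Rep.eta_k ht hq 2 (by norm_num)
  have e4 := Rep.eta_k ht hq 4 (by norm_num)
  have e8 := Rep.eta_k ht hq 8 (by norm_num)
  rw [Nat.cast_one, one_mul, pow_one, pow_one] at e1
  rw [Nat.cast_ofNat] at e2 e4 e8
  have E1 := Rep.EE_pos h0 h1
  have E2 : 0 < Rep.EE (q ^ 2) := Rep.EE_pos (by positivity) (pow_lt_one₀ h0.le h1 (by norm_num))
  have E4 : 0 < Rep.EE (q ^ 4) := Rep.EE_pos (by positivity) (pow_lt_one₀ h0.le h1 (by norm_num))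
  have E8 : 0 < Rep.EE (q ^ 8) := Rep.EE_pos (by positivity) (pow_lt_one₀ h0.le h1 (by norm_num))
  rw [e1, e2, e4, e8] at H
  have u0 : 0 < Real.exp (-(Real.pi * t / 12)) := Real.exp_pos _
  have hu : Real.exp (-(Real.pi * t / 12)) ^ (24 : ℤ) = q := by
    rw [hq]
    have : Real.exp (-(Real.pi * t / 12)) ^ (24 : ℤ) = Real.exp (-(Real.pi * t / 12)) ^ 24 := by norm_cast
    rw [this, ← Real.exp_nat_mul]; congr 1; push_cast; ring
  generalize Real.exp (-(Real.pi * t / 12)) = u at *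
  refine Rep.series_of (by positivity) ?_
  rw [← H]
  norm_cast
  nth_rw 1 [← hu]
  rw [← hk, zpow_add₀ u0.ne', zpow_add₀ u0.ne', zpow_add₀ u0.ne', mul_zpow, mul_zpow, mul_zpow, mul_zpow,
    zpow_mul, zpow_mul, zpow_mul]
  norm_cast
  ring

theorem representation_formula_1
    (a1 a2 : ℕ → ℤ)
    (ha1 : ∀ z : ℂ, 0 < z.im →
      dedekindEta z ^ (-2 : ℤ) * dedekindEta (2 * z) ^ (11 : ℤ) * dedekindEta (4 * z) ^ (-3 : ℤ) * dedekindEta (8 * z) ^ (2 : ℤ)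
        = ∑' m : ℕ, (a1 (m + 1) : ℂ) * Complex.exp (2 * Real.pi * Complex.I * z) ^ (m + 1))
    (ha2 : ∀ z : ℂ, 0 < z.im →
      dedekindEta z ^ (2 : ℤ) * dedekindEta (2 * z) ^ (-3 : ℤ) * dedekindEta (4 * z) ^ (11 : ℤ) * dedekindEta (8 * z) ^ (-2 : ℤ)
        = ∑' m : ℕ, (a2 (m + 1) : ℂ) * Complex.exp (2 * Real.pi * Complex.I * z) ^ (m + 1))
    (n : ℕ) (hn : 0 < n) :
    (repCount ![1, 2, 2, 2, 4, 4, 4, 4] n : ℚ) =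
    (((4 : ℚ) / 11) * (sigmaChi8One n : ℚ) + ((2 : ℚ) / 11) * half sigmaOneChi8 n
      + ((1 : ℚ) / 11) * (a1 n : ℚ) + ((17 : ℚ) / 11) * (a2 n : ℚ)
      + ((48 : ℚ) / 11) * half a1 n + ((16 : ℚ) / 11) * half a2 n) := by
  have s1 : ∀ q : ℝ, 0 < q → q < 1 →
      HasSum (fun n : ℕ => (if n = 0 then 0 else (a1 n : ℝ)) * q ^ n) (Rep.F1 q) :=
    fun q h0 h1 => Rep.a_series (-2) 11 (-3) 2 (by norm_num) ha1 h0 h1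
  have s2 : ∀ q : ℝ, 0 < q → q < 1 →
      HasSum (fun n : ℕ => (if n = 0 then 0 else (a2 n : ℝ)) * q ^ n) (Rep.F2 q) :=
    fun q h0 h1 => Rep.a_series 2 (-3) 11 (-2) (by norm_num) ha2 h0 h1
  have key := Rep.coeff_zero (c := fun n : ℕ =>
    11 * (repCount ![1, 2, 2, 2, 4, 4, 4, 4] n : ℝ) - (if n = 0 then 11 else 0)
      - 4 * (∑ d ∈ n.divisors, Rep.c8 (n / d) * (d : ℝ) ^ 3)
      - 2 * (if 2 ∣ n then (fun n : ℕ => ∑ d ∈ n.divisors, Rep.c8 d * (d : ℝ) ^ 3) (n / 2) else 0)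
      - (if n = 0 then 0 else (a1 n : ℝ)) - 17 * (if n = 0 then 0 else (a2 n : ℝ))
      - 48 * (if 2 ∣ n then (fun n : ℕ => if n = 0 then 0 else (a1 n : ℝ)) (n / 2) else 0)
      - 16 * (if 2 ∣ n then (fun n : ℕ => if n = 0 then 0 else (a2 n : ℝ)) (n / 2) else 0))
    (fun q h0 h1 => by
      have k0 : 0 < q ^ 2 := by positivity
      have k1 : q ^ 2 < 1 := pow_lt_one₀ h0.le h1 (by norm_num)
      have hth := Rep.theta_hs h0 h1 ![1, 2, 2, 2, 4, 4, 4, 4] (by intro i; fin_cases i <;> simp)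
      have h11 : HasSum (fun n : ℕ => (if n = 0 then (11 : ℝ) else 0) * q ^ n) 11 := by
        have := hasSum_ite_eq (0 : ℕ) (11 : ℝ)
        refine Rep.hs_congr this (fun n => ?_) rfl
        rcases Nat.eq_zero_or_pos n with h | h
        · subst h; simp
        · simp [h.ne']
      have hM := Rep.M3_series h0 h1
      have hL := Rep.half_series (Rep.L3_series h0 h1)
      have a := s1 q h0 h1
      have b := s2 q h0 h1
      have c := Rep.half_series (s1 _ k0 k1)
      have d := Rep.half_series (s2 _ k0 k1)
      have tot := (((((((hth.mul_left 11).sub h11).sub (hM.mul_left 4)).sub (hL.mul_left 2)).sub a).sub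
        (b.mul_left 17)).sub (c.mul_left 48)).sub (d.mul_left 16)
      refine Rep.hs_congr tot (fun n => ?_) ?_
      · simp only [repCount]; ring
      · have := Rep.main_id h0 h1
        simp only [Fin.prod_univ_succ, Fin.prod_univ_zero]
        simp
        linarith)
  have kn := key n
  simp only [hn.ne', if_false] at kn
  have hh : ∀ f : ℕ → ℤ, ((half f n : ℚ) : ℝ) = if 2 ∣ n then (f (n / 2) : ℝ) else 0 := by
    intro f; rw [half]; split_ifs <;> simp
  have hz : ∀ f : ℕ → ℤ, (if 2 ∣ n then (if n / 2 = 0 then 0 else (f (n / 2) : ℝ)) else 0)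
      = ((half f n : ℚ) : ℝ) := by
    intro f; rw [hh]; split_ifs with h1 h2
    · omega
    · rfl
    · rfl
  have hc1 : (sigmaChi8One n : ℝ) = ∑ d ∈ n.divisors, Rep.c8 (n / d) * (d : ℝ) ^ 3 := by
    simp [sigmaChi8One, Rep.c8]
  have hc2 : ∀ m : ℕ, (sigmaOneChi8 m : ℝ) = ∑ d ∈ m.divisors, Rep.c8 d * (d : ℝ) ^ 3 := by
    intro m; simp [sigmaOneChi8, Rep.c8]
  rw [hz, hz, ← hc1, ← hc2, ← hh] at kn
  have : ((repCount ![1, 2, 2, 2, 4, 4, 4, 4] n : ℚ) : ℝ) = ((((4 : ℚ) / 11) * (sigmaChi8One n : ℚ) + ((2 : ℚ) / 11) * half sigmaOneChi8 n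
      + ((1 : ℚ) / 11) * (a1 n : ℚ) + ((17 : ℚ) / 11) * (a2 n : ℚ)
      + ((48 : ℚ) / 11) * half a1 n + ((16 : ℚ) / 11) * half a2 n : ℚ) : ℝ) := by
    push_cast
    linarith
  exact_mod_cast this
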